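/- For every c > 0, the zero spacings of Pₙ recover the clock behavior away from the origin in the limit: lim_{j→±∞} liminf_{n→∞} (n/π)(x_{j+1}^{(n)} − x_j^{(n)}) = lim_{j→±∞} limsup_{n→∞} (n/π)(x_{j+1}^{(n)} − x_j^{(n)}) = 1. -/

import Mathlib

open Filter Set MeasureTheory Polynomial

/-- The integral of a polynomial over `[-1, 1]` against the weight `v`. -/
noncomputable def weightIntegral (v : ℝ → ℝ) (p : ℝ[X]) : ℝ :=
  ∫ y in (-1 : ℝ)..1, p.eval y * v y

section WeightIntegral

variable {v v' : ℝ → ℝ}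

lemma intervalIntegrable_eval_mul (hv : IntervalIntegrable v volume (-1) 1) (p : ℝ[X]) :
    IntervalIntegrable (fun y => p.eval y * v y) volume (-1) 1 :=
  hv.continuousOn_mul p.continuous.continuousOn

lemma weightIntegral_add (hv : IntervalIntegrable v volume (-1) 1) (p q : ℝ[X]) :
    weightIntegral v (p + q) = weightIntegral v p + weightIntegral v q := by
  unfold weightIntegral
  rw [← intervalIntegral.integral_add (intervalIntegrable_eval_mul hv p)
    (intervalIntegrable_eval_mul hv q)]
  simp [add_mul]

lemma weightIntegral_C_mul (a : ℝ) (p : ℝ[X]) :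
    weightIntegral v (C a * p) = a * weightIntegral v p := by
  unfold weightIntegral
  rw [← intervalIntegral.integral_const_mul]
  simp [mul_assoc]

lemma weightIntegral_sub (hv : IntervalIntegrable v volume (-1) 1) (p q : ℝ[X]) :
    weightIntegral v (p - q) = weightIntegral v p - weightIntegral v q := by
  unfold weightIntegral
  rw [← intervalIntegral.integral_sub (intervalIntegrable_eval_mul hv p)
    (intervalIntegrable_eval_mul hv q)]
  simp [sub_mul]

lemma weightIntegral_zero : weightIntegral v 0 = 0 := by simp [weightIntegral]

lemma weightIntegral_sum (hv : IntervalIntegrable v volume (-1) 1) {ι : Type*} (s : Finset ι)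
    (f : ι → ℝ[X]) : weightIntegral v (∑ i ∈ s, f i) = ∑ i ∈ s, weightIntegral v (f i) := by
  classical
  induction s using Finset.induction_on with
  | empty => simp [weightIntegral_zero]
  | insert a s ha ih => rw [Finset.sum_insert ha, Finset.sum_insert ha, weightIntegral_add hv, ih]

lemma weightIntegral_mono (hv : IntervalIntegrable v volume (-1) 1)
    (hv' : IntervalIntegrable v' volume (-1) 1) {p q : ℝ[X]}
    (h : ∀ y ∈ Ioo (-1 : ℝ) 1, p.eval y * v y ≤ q.eval y * v' y) :
    weightIntegral v p ≤ weightIntegral v' q :=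
  intervalIntegral.integral_mono_on_of_le_Ioo (by norm_num) (intervalIntegrable_eval_mul hv p)
    (intervalIntegrable_eval_mul hv' q) h

lemma weightIntegral_nonneg (hpos : ∀ y ∈ Ioo (-1 : ℝ) 1, 0 < v y) {p : ℝ[X]}
    (hp : ∀ y ∈ Ioo (-1 : ℝ) 1, 0 ≤ p.eval y) : 0 ≤ weightIntegral v p := by
  unfold weightIntegral
  rw [intervalIntegral.integral_of_le (by norm_num), integral_Ioc_eq_integral_Ioo]
  exact setIntegral_nonneg measurableSet_Ioo fun y hy => mul_nonneg (hp y hy) (hpos y hy).le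

lemma weightIntegral_pos (hv : IntervalIntegrable v volume (-1) 1)
    (hpos : ∀ y ∈ Ioo (-1 : ℝ) 1, 0 < v y) {p : ℝ[X]} (h0 : p ≠ 0)
    (hp : ∀ y ∈ Ioo (-1 : ℝ) 1, 0 ≤ p.eval y) : 0 < weightIntegral v p := by
  refine lt_of_le_of_ne (weightIntegral_nonneg hpos hp) fun h => ?_
  unfold weightIntegral at h
  have hInt := intervalIntegrable_eval_mul hv p
  rw [intervalIntegrable_iff_integrableOn_Ioo_of_le (by norm_num)] at hInt
  rw [intervalIntegral.integral_of_le (by norm_num), integral_Ioc_eq_integral_Ioo, eq_comm,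
    setIntegral_eq_zero_iff_of_nonneg_ae ?_ hInt] at h
  · have h1 : ∀ᵐ y ∂(volume.restrict (Ioo (-1 : ℝ) 1)), False := by
      have h2 : ∀ᵐ y ∂(volume.restrict (Ioo (-1 : ℝ) 1)), y ∉ {y | p.IsRoot y} :=
        ae_restrict_of_ae ((Polynomial.finite_setOfPred_isRoot h0).countable.ae_notMem _)
      filter_upwards [h, h2, ae_restrict_mem measurableSet_Ioo] with y hy hy2 hy3
      simp only [Pi.zero_apply, mul_eq_zero] at hy
      rcases hy with hy | hy
      · exact hy2 hy
      · exact (hpos y hy3).ne' hy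
    rw [ae_iff] at h1
    simp at h1
    norm_num at h1
  · filter_upwards [ae_restrict_mem measurableSet_Ioo] with y hy
    exact mul_nonneg (hp y hy) (hpos y hy).le

lemma weightIntegral_mul_sq_le (hv : IntervalIntegrable v volume (-1) 1)
    (hpos : ∀ y ∈ Ioo (-1 : ℝ) 1, 0 < v y) (f p : ℝ[X]) :
    weightIntegral v (f * p) ^ 2 ≤ weightIntegral v (f ^ 2) * weightIntegral v (p ^ 2) := by
  by_cases hf : f = 0
  · simp [hf, weightIntegral_zero]
  have hA : 0 < weightIntegral v (f ^ 2) :=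
    weightIntegral_pos hv hpos (pow_ne_zero 2 hf) fun y _ => by simp [sq_nonneg]
  set A := weightIntegral v (f ^ 2)
  set B := weightIntegral v (f * p) with hB
  have h : 0 ≤ weightIntegral v ((C A * p - C B * f) ^ 2) :=
    weightIntegral_nonneg hpos fun y _ => by rw [eval_pow]; positivity
  have e : (C A * p - C B * f) ^ 2
      = C (A ^ 2) * p ^ 2 - C (2 * A * B) * (f * p) + C (B ^ 2) * f ^ 2 := by
    simp only [C_mul, C_pow]
    rw [show (C (2 : ℝ) : ℝ[X]) = 2 from rfl]
    ring
  rw [e, weightIntegral_add hv, weightIntegral_sub hv, weightIntegral_C_mul,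
    weightIntegral_C_mul, weightIntegral_C_mul] at h
  nlinarith [h, hA]

end WeightIntegral

section OrthogonalPolynomial

variable {v : ℝ → ℝ} {P : ℝ[X]} {n : ℕ}

lemma weightIntegral_mul_eq_zero_of_degree_lt (hv : IntervalIntegrable v volume (-1) 1)
    (horth : ∀ k < n, weightIntegral v (P * X ^ k) = 0) {s : ℝ[X]} (hs : s.degree < n) :
    weightIntegral v (P * s) = 0 := by
  rcases eq_or_ne s 0 with rfl | h0
  · simp [weightIntegral_zero]
  rw [s.as_sum_range' n ((natDegree_lt_iff_degree_lt h0).2 hs), Finset.mul_sum,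
    weightIntegral_sum hv]
  refine Finset.sum_eq_zero fun i hi => ?_
  rw [← C_mul_X_pow_eq_monomial, mul_left_comm, weightIntegral_C_mul,
    horth i (Finset.mem_range.1 hi), mul_zero]

lemma not_dvd_of_nonneg (hv : IntervalIntegrable v volume (-1) 1)
    (hpos : ∀ y ∈ Ioo (-1 : ℝ) 1, 0 < v y) (hP : P ≠ 0) (hdeg : P.natDegree = n)
    (horth : ∀ k < n, weightIntegral v (P * X ^ k) = 0) {q : ℝ[X]} (hq : 0 < q.natDegree)
    (hq0 : ∀ y, 0 ≤ q.eval y) : ¬ q ∣ P := by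
  rintro ⟨s, rfl⟩
  have hq' := left_ne_zero_of_mul hP
  have hs' := right_ne_zero_of_mul hP
  have h1 : weightIntegral v (q * s * s) = 0 := by
    refine weightIntegral_mul_eq_zero_of_degree_lt hv horth ?_
    rw [← natDegree_lt_iff_degree_lt hs', ← hdeg, natDegree_mul hq' hs']
    omega
  refine (weightIntegral_pos hv hpos (p := q * s * s) (mul_ne_zero hP hs') fun y _ => ?_).ne' h1
  rw [mul_assoc, eval_mul, eval_mul]
  exact mul_nonneg (hq0 y) (mul_self_nonneg _)

lemma splits_of_orthogonal (hv : IntervalIntegrable v volume (-1) 1)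
    (hpos : ∀ y ∈ Ioo (-1 : ℝ) 1, 0 < v y) (hP : P ≠ 0) (hdeg : P.natDegree = n)
    (horth : ∀ k < n, weightIntegral v (P * X ^ k) = 0) : P.Splits := by
  refine Splits.of_splits_map (algebraMap ℝ ℂ) (IsAlgClosed.splits _) fun z hz => ?_
  have hz0 : aeval z P = 0 := by
    rw [mem_roots (by simpa [Polynomial.map_eq_zero] using hP)] at hz
    simpa [IsRoot, eval_map_algebraMap] using hz
  by_cases him : z.im = 0
  · exact ⟨z.re, Complex.ext (by simp) (by simp [him])⟩
  · refine absurd (P.quadratic_dvd_of_aeval_eq_zero_im_ne_zero hz0 him)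
      (not_dvd_of_nonneg hv hpos hP hdeg horth ?_ fun y => ?_)
    · have : (X ^ 2 - C (2 * z.re) * X + C (‖z‖ ^ 2) : ℝ[X]).natDegree = 2 := by compute_degree!
      omega
    · have h : ‖z‖ ^ 2 = z.re ^ 2 + z.im ^ 2 := by
        rw [← Complex.normSq_eq_norm_sq, Complex.normSq_apply]; ring
      simp only [eval_add, eval_sub, eval_pow, eval_X, eval_mul, eval_C, h]
      nlinarith [sq_nonneg (y - z.re), sq_nonneg z.im]

lemma nodup_roots_of_orthogonal (hv : IntervalIntegrable v volume (-1) 1)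
    (hpos : ∀ y ∈ Ioo (-1 : ℝ) 1, 0 < v y) (hP : P ≠ 0) (hdeg : P.natDegree = n)
    (horth : ∀ k < n, weightIntegral v (P * X ^ k) = 0) : P.roots.Nodup := by
  rw [Multiset.nodup_iff_count_le_one]
  intro a
  rw [count_roots]
  by_contra! h
  refine not_dvd_of_nonneg hv hpos hP hdeg horth (q := (X - C a) ^ 2) ?_ (fun y => ?_)
    ((pow_dvd_pow _ h).trans (pow_rootMultiplicity_dvd P a))
  · simp
  · rw [eval_pow]; positivity

lemma exists_reproducing_of_root (hv : IntervalIntegrable v volume (-1) 1)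
    (hpos : ∀ y ∈ Ioo (-1 : ℝ) 1, 0 < v y) (hP : P ≠ 0) (hdeg : P.natDegree = n)
    (horth : ∀ k < n, weightIntegral v (P * X ^ k) = 0) {ξ : ℝ} (hξ : P.eval ξ = 0) :
    ∃ k : ℝ[X], k.degree < n ∧ (∀ p : ℝ[X], p.degree < n → weightIntegral v (k * p) = p.eval ξ) ∧
      0 < k.eval ξ ∧ ∃ a ≠ 0, P = C a * ((X - C ξ) * k) := by
  obtain ⟨R, hR⟩ := dvd_iff_isRoot.2 hξ
  have hR0 : R ≠ 0 := by rintro rfl; simp [hR] at hP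
  have hn : R.natDegree + 1 = n := by
    rw [← hdeg, hR, natDegree_mul (X_sub_C_ne_zero ξ) hR0, natDegree_X_sub_C]; omega
  have hRdeg : R.degree < n := by rw [← natDegree_lt_iff_degree_lt hR0]; omega
  have key : ∀ p : ℝ[X], p.degree < n →
      weightIntegral v (R * p) = p.eval ξ * weightIntegral v R := by
    intro p hp
    have h1 : R * p = P * (p /ₘ (X - C ξ)) + C (p.eval ξ) * R := by
      conv_lhs => rw [← modByMonic_add_div p (X - C ξ), modByMonic_X_sub_C_eq_C_eval]
      rw [hR]; ring
    rw [h1, weightIntegral_add hv, weightIntegral_C_mul,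
      weightIntegral_mul_eq_zero_of_degree_lt hv horth, zero_add]
    exact (degree_divByMonic_le p _).trans_lt hp
  have hRR : 0 < weightIntegral v (R * R) :=
    weightIntegral_pos hv hpos (mul_ne_zero hR0 hR0) fun y _ => by
      rw [eval_mul]; exact mul_self_nonneg _
  rw [key R hRdeg] at hRR
  have hI : weightIntegral v R ≠ 0 := right_ne_zero_of_mul hRR.ne'
  refine ⟨C (weightIntegral v R)⁻¹ * R, ?_, fun p hp => ?_, ?_, weightIntegral v R, hI, ?_⟩
  · rwa [degree_C_mul (inv_ne_zero hI)]
  · rw [mul_assoc, weightIntegral_C_mul, key p hp]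
    field_simp
  · rw [eval_mul, eval_C]
    have : (weightIntegral v R)⁻¹ * eval ξ R
      = (weightIntegral v R)⁻¹ ^ 2 * (eval ξ R * weightIntegral v R) := by field_simp
    rw [this]; positivity
  · rw [mul_left_comm (X - C ξ), ← mul_assoc, ← C_mul, mul_inv_cancel₀ hI, C_1, one_mul, hR]

lemma weightIntegral_nonneg_of_nonneg_on_roots (hv : IntervalIntegrable v volume (-1) 1)
    (hpos : ∀ y ∈ Ioo (-1 : ℝ) 1, 0 < v y) (hP : P ≠ 0) (hdeg : P.natDegree = n)
    (horth : ∀ k < n, weightIntegral v (P * X ^ k) = 0) {r : ℝ[X]} (hr : r.natDegree < 2 * n)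
    (hr0 : ∀ x, P.eval x = 0 → 0 ≤ r.eval x) : 0 ≤ weightIntegral v r := by
  classical
  have hn : 0 < n := by omega
  have H := fun (ξ : ℝ) (hξ : P.eval ξ = 0) =>
    exists_reproducing_of_root hv hpos hP hdeg horth hξ
  choose! k hkdeg hk hkpos hkP using H
  set S := P.roots.toFinset with hS
  have hmem : ∀ x, x ∈ S ↔ P.eval x = 0 := fun x => by simp [hS, hP]
  have hkz : ∀ ξ ∈ S, ∀ x ∈ S, x ≠ ξ → (k ξ).eval x = 0 := by
    intro ξ hξ x hx hne
    obtain ⟨a, ha, h⟩ := hkP ξ ((hmem ξ).1 hξ)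
    have h2 := (hmem x).1 hx
    rw [h] at h2
    simpa [ha, sub_ne_zero.2 hne] using h2
  set q : ℝ[X] := ∑ ξ ∈ S, C (r.eval ξ / (k ξ).eval ξ ^ 2) * k ξ ^ 2 with hq
  have hqdeg : q.natDegree < 2 * n := by
    have : q.natDegree ≤ 2 * n - 1 := by
      refine natDegree_sum_le_of_forall_le _ _ fun ξ hξ => ?_
      refine (natDegree_C_mul_le _ _).trans (natDegree_pow_le.trans ?_)
      have h0 : k ξ ≠ 0 := fun h => by simpa [h] using hkpos ξ ((hmem ξ).1 hξ)
      have := (natDegree_lt_iff_degree_lt h0).2 (hkdeg ξ ((hmem ξ).1 hξ))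
      omega
    omega
  have hev : ∀ x ∈ S, q.eval x = r.eval x := by
    intro x hx
    rw [hq, eval_finsetSum, Finset.sum_eq_single x]
    · have := hkpos x ((hmem x).1 hx)
      simp only [eval_mul, eval_C, eval_pow]
      field_simp
    · intro ξ hξ hne
      simp [hkz ξ hξ x hx hne.symm]
    · exact fun h => absurd hx h
  have hq_nonneg : 0 ≤ weightIntegral v q := by
    refine weightIntegral_nonneg hpos fun y _ => ?_
    rw [hq, eval_finsetSum]
    refine Finset.sum_nonneg fun ξ hξ => ?_
    simp only [eval_mul, eval_C, eval_pow]
    have := hr0 ξ ((hmem ξ).1 hξ)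
    positivity
  suffices h : weightIntegral v (r - q) = 0 by
    rw [weightIntegral_sub hv] at h; linarith
  by_cases hd0 : r - q = 0
  · rw [hd0, weightIntegral_zero]
  have hdvd : P ∣ r - q := by
    refine (splits_of_orthogonal hv hpos hP hdeg horth).dvd_of_roots_le_roots hP ?_
    rw [Multiset.le_iff_subset (nodup_roots_of_orthogonal hv hpos hP hdeg horth)]
    intro x hx
    have hx' : x ∈ S := by simpa [hS] using hx
    rw [mem_roots hd0, IsRoot, eval_sub, hev x hx', sub_self]
  obtain ⟨s, hs⟩ := hdvd
  rw [hs]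
  have hs0 : s ≠ 0 := by rintro rfl; simp [hs] at hd0
  refine weightIntegral_mul_eq_zero_of_degree_lt hv horth ?_
  rw [← natDegree_lt_iff_degree_lt hs0]
  have h1 : (r - q).natDegree < 2 * n := (natDegree_sub_le _ _).trans_lt (max_lt hr hqdeg)
  rw [hs, natDegree_mul hP hs0] at h1
  omega

end OrthogonalPolynomial

section Dirichlet

/-- The Dirichlet kernel `1 + 2 cos u + ⋯ + 2 cos (m u)`. -/
noncomputable def dirichletSum (m : ℕ) (u : ℝ) : ℝ :=
  1 + 2 * ∑ k ∈ Finset.range m, Real.cos ((k + 1 : ℝ) * u)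

lemma dirichletSum_mul_sin (m : ℕ) (u : ℝ) :
    dirichletSum m u * Real.sin (u / 2) = Real.sin ((m + 1 / 2 : ℝ) * u) := by
  induction m with
  | zero => simp [dirichletSum]; congr 1; ring
  | succ m ih =>
    unfold dirichletSum at ih ⊢
    rw [Finset.sum_range_succ, mul_add, ← add_assoc, add_mul, ih]
    have h1 : ((m + 1 : ℕ) + 1 / 2 : ℝ) * u = (m + 1 : ℝ) * u + u / 2 := by push_cast; ring
    have h2 : ((m : ℝ) + 1 / 2) * u = (m + 1 : ℝ) * u - u / 2 := by ring
    rw [h1, h2, Real.sin_add, Real.sin_sub]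
    ring

lemma abs_dirichletSum_le (m : ℕ) (u : ℝ) : |dirichletSum m u| ≤ 2 * m + 1 := by
  have h : |∑ k ∈ Finset.range m, Real.cos ((k + 1 : ℝ) * u)| ≤ m := by
    refine (Finset.abs_sum_le_sum_abs _ _).trans ?_
    refine (Finset.sum_le_sum fun k _ => Real.abs_cos_le_one _).trans ?_
    simp
  unfold dirichletSum
  rw [abs_le] at h ⊢
  constructor <;> linarith [h.1, h.2]

lemma abs_dirichletSum_mul_abs_sin_le (m : ℕ) (u : ℝ) :
    |dirichletSum m u| * |Real.sin (u / 2)| ≤ 1 := by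
  rw [← abs_mul, dirichletSum_mul_sin]
  exact Real.abs_sin_le_one _

lemma dirichletSum_zero (m : ℕ) : dirichletSum m 0 = 2 * m + 1 := by
  simp [dirichletSum]; ring

end Dirichlet

section ChebyshevKernel

open Polynomial.Chebyshev

/-- The Chebyshev weight of the first kind. -/
noncomputable def chebyshevWeight (y : ℝ) : ℝ := √(1 - y ^ 2)⁻¹

lemma intervalIntegrable_chebyshevWeight : IntervalIntegrable chebyshevWeight volume (-1) 1 :=
  intervalIntegrable_sqrt_one_sub_sq_inv

lemma one_le_chebyshevWeight {y : ℝ} (hy : y ∈ Ioo (-1 : ℝ) 1) : 1 ≤ chebyshevWeight y := by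
  unfold chebyshevWeight
  rw [Real.one_le_sqrt]
  have h1 : 0 < 1 - y ^ 2 := by nlinarith [hy.1, hy.2]
  rw [one_le_inv₀ h1]
  nlinarith [sq_nonneg y]

lemma chebyshevWeight_pos {y : ℝ} (hy : y ∈ Ioo (-1 : ℝ) 1) : 0 < chebyshevWeight y :=
  one_pos.trans_le (one_le_chebyshevWeight hy)

lemma weightIntegral_chebyshevWeight (p : ℝ[X]) :
    weightIntegral chebyshevWeight p = ∫ x, p.eval x ∂measureT :=
  (integral_measureT _).symm

lemma weightIntegral_T_mul_T (i j : ℕ) :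
    weightIntegral chebyshevWeight (T ℝ i * T ℝ j)
      = if i = j then (if i = 0 then Real.pi else Real.pi / 2) else 0 := by
  rw [weightIntegral_chebyshevWeight]
  simp_rw [eval_mul]
  split_ifs with h h0
  · subst h; subst h0; exact_mod_cast integral_eval_T_real_mul_self_measureT_zero
  · subst h; exact integral_T_real_mul_self_measureT_of_ne_zero h0
  · exact integral_eval_T_real_mul_eval_T_real_measureT_of_ne h

/-- The reproducing kernel at `x`, for the Chebyshev weight, of the polynomials of degree at
most `m`. -/
noncomputable def chebyshevKernel (m : ℕ) (x : ℝ) : ℝ[X] :=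
  C (1 / Real.pi) * (1 + C 2 * ∑ k ∈ Finset.range m,
    C ((T ℝ ((k + 1 : ℕ) : ℤ)).eval x) * T ℝ ((k + 1 : ℕ) : ℤ))

lemma natDegree_chebyshevKernel_le (m : ℕ) (x : ℝ) : (chebyshevKernel m x).natDegree ≤ m := by
  unfold chebyshevKernel
  refine (natDegree_C_mul_le _ _).trans (natDegree_add_le_of_degree_le (by simp) ?_)
  refine (natDegree_C_mul_le _ _).trans (natDegree_sum_le_of_forall_le _ _ fun k hk => ?_)
  refine (natDegree_C_mul_le _ _).trans ?_
  rw [natDegree_T]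
  have := Finset.mem_range.1 hk
  omega

lemma eval_chebyshevKernel_cos (m : ℕ) (φ θ : ℝ) :
    (chebyshevKernel m (Real.cos φ)).eval (Real.cos θ)
      = (dirichletSum m (φ - θ) + dirichletSum m (φ + θ)) / (2 * Real.pi) := by
  have hk : ∀ k ∈ Finset.range m, 2 * (Real.cos ((k + 1 : ℝ) * φ) * Real.cos ((k + 1 : ℝ) * θ))
      = Real.cos ((k + 1 : ℝ) * (φ - θ)) + Real.cos ((k + 1 : ℝ) * (φ + θ)) := by
    intro k _
    rw [mul_sub, mul_add, Real.cos_sub, Real.cos_add]; ring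
  unfold chebyshevKernel dirichletSum
  simp only [eval_mul, eval_C, eval_add, eval_one, eval_finsetSum, T_real_cos]
  have h := Finset.sum_congr rfl hk
  rw [← Finset.mul_sum, Finset.sum_add_distrib] at h
  push_cast
  rw [h]
  have := Real.pi_pos
  generalize (∑ x ∈ Finset.range m, Real.cos (((x : ℝ) + 1) * (φ - θ))) = A
  generalize (∑ x ∈ Finset.range m, Real.cos (((x : ℝ) + 1) * (φ + θ))) = B
  field_simp
  ring

lemma weightIntegral_chebyshevKernel_mul {m : ℕ} (x : ℝ) {p : ℝ[X]} (hp : p.natDegree ≤ m) :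
    weightIntegral chebyshevWeight (chebyshevKernel m x * p) = p.eval x := by
  have hv := intervalIntegrable_chebyshevWeight
  have hπ := Real.pi_pos
  have hT : ∀ j ≤ m, weightIntegral chebyshevWeight (chebyshevKernel m x * T ℝ j)
      = (T ℝ j).eval x := by
    intro j hj
    have e : chebyshevKernel m x * T ℝ j = C (1 / Real.pi) * (T ℝ (0 : ℕ) * T ℝ j + C 2 *
        ∑ k ∈ Finset.range m, C ((T ℝ ((k + 1 : ℕ) : ℤ)).eval x) *
          (T ℝ ((k + 1 : ℕ) : ℤ) * T ℝ j)) := by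
      rw [chebyshevKernel, mul_assoc, add_mul, mul_assoc (C 2), Finset.sum_mul]
      simp [mul_assoc]
    rw [e, weightIntegral_C_mul, weightIntegral_add hv, weightIntegral_C_mul,
      weightIntegral_sum hv]
    simp_rw [weightIntegral_C_mul, weightIntegral_T_mul_T]
    rcases j with _ | j
    · simp [hπ.ne']
    · have : ∀ k ∈ Finset.range m, (T ℝ ((k + 1 : ℕ) : ℤ)).eval x *
          (if k + 1 = j + 1 then (if k + 1 = 0 then Real.pi else Real.pi / 2) else 0)
          = if k = j then (T ℝ ((j + 1 : ℕ) : ℤ)).eval x * (Real.pi / 2) else 0 := by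
        intro k _
        by_cases h : k = j
        · subst h; simp
        · simp [h]
      rw [Finset.sum_congr rfl this, Finset.sum_ite_eq']
      simp only [Finset.mem_range, show j < m by omega, if_true]
      simp
      field_simp
  have hspan : p ∈ Submodule.span ℝ (chebyshevTsequence ℝ '' Set.Iio (m + 1)) := by
    rw [Polynomial.Sequence.span_degreeLT _ fun i _ => by
      simp [chebyshevTsequence]]
    rw [mem_degreeLT]
    exact degree_le_natDegree.trans_lt (by exact_mod_cast Nat.lt_succ_of_le hp)
  clear hp
  induction hspan using Submodule.span_induction with
  | mem q hq =>
    obtain ⟨j, hj, rfl⟩ := hq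
    exact hT j (Nat.lt_succ_iff.1 hj)
  | zero => simp [weightIntegral_zero]
  | add p q _ _ h1 h2 => rw [mul_add, weightIntegral_add hv, h1, h2, eval_add]
  | smul a p _ h => rw [smul_eq_C_mul, mul_left_comm, weightIntegral_C_mul, h, eval_mul, eval_C]

lemma eval_sq_le_chebyshevKernel {m : ℕ} (x : ℝ) {p : ℝ[X]} (hp : p.natDegree ≤ m) :
    p.eval x ^ 2 ≤ (chebyshevKernel m x).eval x * weightIntegral chebyshevWeight (p ^ 2) := by
  rw [← weightIntegral_chebyshevKernel_mul x hp,
    ← weightIntegral_chebyshevKernel_mul x (natDegree_chebyshevKernel_le m x), ← sq]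
  exact weightIntegral_mul_sq_le intervalIntegrable_chebyshevWeight
    (fun y hy => chebyshevWeight_pos hy) _ _

lemma sub_eval_sq_le {m : ℕ} (φ θ : ℝ) {p : ℝ[X]} (hp : p.natDegree ≤ m) :
    (p.eval (Real.cos φ) - p.eval (Real.cos θ)) ^ 2
      ≤ (m : ℝ) ^ 3 * (φ - θ) ^ 2 * weightIntegral chebyshevWeight (p ^ 2) := by
  have hv := intervalIntegrable_chebyshevWeight
  have hpos : ∀ y ∈ Ioo (-1 : ℝ) 1, 0 < chebyshevWeight y := fun y hy => chebyshevWeight_pos hy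
  have hrep : ∀ q : ℝ[X], q.natDegree ≤ m → weightIntegral chebyshevWeight
      ((chebyshevKernel m (Real.cos φ) - chebyshevKernel m (Real.cos θ)) * q)
      = q.eval (Real.cos φ) - q.eval (Real.cos θ) := fun q hq => by
    rw [sub_mul, weightIntegral_sub hv, weightIntegral_chebyshevKernel_mul _ hq,
      weightIntegral_chebyshevKernel_mul _ hq]
  have h1 := weightIntegral_mul_sq_le hv hpos
    (chebyshevKernel m (Real.cos φ) - chebyshevKernel m (Real.cos θ)) p
  rw [hrep p hp, sq (_ - chebyshevKernel m (Real.cos θ)),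
    hrep _ ((natDegree_sub_le _ _).trans (max_le (natDegree_chebyshevKernel_le _ _)
      (natDegree_chebyshevKernel_le _ _)))] at h1
  refine h1.trans (mul_le_mul_of_nonneg_right ?_
    (weightIntegral_nonneg hpos fun y _ => by rw [eval_pow]; positivity))
  have e : (chebyshevKernel m (Real.cos φ) - chebyshevKernel m (Real.cos θ)).eval (Real.cos φ)
      - (chebyshevKernel m (Real.cos φ) - chebyshevKernel m (Real.cos θ)).eval (Real.cos θ)
      = 2 / Real.pi * ∑ k ∈ Finset.range m,
        (Real.cos ((k + 1 : ℝ) * φ) - Real.cos ((k + 1 : ℝ) * θ)) ^ 2 := by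
    unfold chebyshevKernel
    simp only [eval_mul, eval_C, eval_add, eval_sub, eval_one, eval_finsetSum, T_real_cos]
    push_cast
    have : ∀ k ∈ Finset.range m, (Real.cos ((k + 1 : ℝ) * φ) - Real.cos ((k + 1 : ℝ) * θ)) ^ 2
      = Real.cos ((k + 1 : ℝ) * φ) * Real.cos ((k + 1 : ℝ) * φ)
        - Real.cos ((k + 1 : ℝ) * θ) * Real.cos ((k + 1 : ℝ) * φ)
        - Real.cos ((k + 1 : ℝ) * φ) * Real.cos ((k + 1 : ℝ) * θ)
        + Real.cos ((k + 1 : ℝ) * θ) * Real.cos ((k + 1 : ℝ) * θ) := fun k _ => by ring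
    rw [Finset.sum_congr rfl this]
    simp only [Finset.sum_add_distrib, Finset.sum_sub_distrib]
    ring
  rw [e]
  have hπ : 2 / Real.pi ≤ 1 := by
    rw [div_le_one Real.pi_pos]; exact Real.two_le_pi
  have hsum : ∑ k ∈ Finset.range m, (Real.cos ((k + 1 : ℝ) * φ) - Real.cos ((k + 1 : ℝ) * θ)) ^ 2
      ≤ ∑ k ∈ Finset.range m, (m : ℝ) ^ 2 * (φ - θ) ^ 2 := by
    refine Finset.sum_le_sum fun k hk => ?_
    have hkm : ((k + 1 : ℕ) : ℝ) ≤ m := by exact_mod_cast Finset.mem_range.1 hk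
    push_cast at hkm
    rw [← mul_pow]
    refine sq_le_sq.2 ((Real.abs_cos_sub_cos_le _ _).trans ?_)
    rw [← mul_sub, abs_mul, abs_mul]
    refine mul_le_mul_of_nonneg_right ?_ (abs_nonneg _)
    rw [abs_of_nonneg (by positivity), abs_of_nonneg (by positivity)]
    exact hkm
  calc _ ≤ 1 * ∑ k ∈ Finset.range m, (Real.cos ((k + 1 : ℝ) * φ) - Real.cos ((k + 1 : ℝ) * θ)) ^ 2 :=
        mul_le_mul_of_nonneg_right hπ (Finset.sum_nonneg fun k _ => sq_nonneg _)
    _ ≤ _ := by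
        rw [one_mul]
        refine hsum.trans (le_of_eq ?_)
        simp
        ring

lemma abs_chebyshevKernel_sub_le (m : ℕ) {φ θ : ℝ} (hφ : |Real.cos φ| ≤ 1 / 2)
    (hφ0 : φ ∈ Icc 0 Real.pi) (hθ : θ ∈ Icc 0 Real.pi) :
    |2 * Real.pi * (chebyshevKernel m (Real.cos φ)).eval (Real.cos θ) - dirichletSum m (φ - θ)|
      ≤ 2 := by
  have hπ := Real.pi_pos
  have h1 : 2 * Real.pi * (chebyshevKernel m (Real.cos φ)).eval (Real.cos θ)
      - dirichletSum m (φ - θ) = dirichletSum m (φ + θ) := by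
    rw [eval_chebyshevKernel_cos]; field_simp; ring
  rw [h1]
  have hlo : Real.pi / 3 ≤ φ := by
    by_contra! h
    have := Real.cos_lt_cos_of_nonneg_of_le_pi hφ0.1 (by linarith) h
    rw [Real.cos_pi_div_three] at this
    linarith [(abs_le.1 hφ).2]
  have hhi : φ ≤ 2 * Real.pi / 3 := by
    by_contra! h
    have := Real.cos_lt_cos_of_nonneg_of_le_pi (by positivity) hφ0.2 h
    have e : Real.cos (2 * Real.pi / 3) = -(1 / 2) := by
      rw [show 2 * Real.pi / 3 = Real.pi - Real.pi / 3 by ring, Real.cos_pi_sub,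
        Real.cos_pi_div_three]
    rw [e] at this
    linarith [(abs_le.1 hφ).1]
  have hs : 1 / 2 ≤ Real.sin ((φ + θ) / 2) := by
    rw [← Real.cos_pi_div_three, ← Real.cos_sub_pi_div_two, ← Real.cos_abs (_ - _)]
    refine Real.cos_le_cos_of_nonneg_of_le_pi (abs_nonneg _) (by linarith) ?_
    rw [abs_le]
    constructor <;> linarith [hθ.1, hθ.2]
  have h2 := abs_dirichletSum_mul_abs_sin_le m (φ + θ)
  rw [abs_of_pos (a := Real.sin _) (by linarith)] at h2
  nlinarith [abs_nonneg (dirichletSum m (φ + θ))]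

end ChebyshevKernel

/-- A weight on `(-1, 1)` which is comparable to `1` up to powers of `1 - y ^ 2`, and has the
right limit `W > 0` at the origin. -/
structure IsRegularRight (v : ℝ → ℝ) (k : ℕ) (B W : ℝ) : Prop where
  intervalIntegrable : IntervalIntegrable v volume (-1) 1
  const_pos : 0 < B
  limit_pos : 0 < W
  upper : ∀ y ∈ Ioo (-1 : ℝ) 1, ((1 - y ^ 2) ^ k) ^ 2 * v y ≤ B
  lower : ∀ y ∈ Ioo (-1 : ℝ) 1, ((1 - y ^ 2) ^ k) ^ 2 * chebyshevWeight y ≤ B * v y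
  tendsto : Tendsto v (nhdsWithin 0 (Ioi 0)) (nhds W)

section Peak

variable {v : ℝ → ℝ} {k : ℕ} {B W : ℝ}

lemma IsRegularRight.pos (hv : IsRegularRight v k B W) : ∀ y ∈ Ioo (-1 : ℝ) 1, 0 < v y := by
  intro y hy
  have h1 : 0 < 1 - y ^ 2 := by nlinarith [hy.1, hy.2]
  have h2 := hv.lower y hy
  have h3 := chebyshevWeight_pos hy
  have : 0 < B * v y := lt_of_lt_of_le (by positivity) h2
  exact pos_of_mul_pos_right this hv.const_pos.le

lemma le_cos_sub_cos {φ θ d : ℝ} (hθ : 0 ≤ θ) (hθφ : θ ≤ φ) (hφ : φ ≤ Real.pi)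
    (h0 : 0 ≤ Real.cos φ) (hd : Real.cos θ ≤ d) :
    (1 - d ^ 2) * (φ - θ) ≤ Real.cos θ - Real.cos φ := by
  have key := (convex_Icc θ φ).mul_sub_le_image_sub_of_le_deriv (f := fun t => -Real.cos t)
    (C := 1 - d ^ 2) (by fun_prop) (by fun_prop) (fun t ht => ?_) θ (left_mem_Icc.2 hθφ) φ
    (right_mem_Icc.2 hθφ) hθφ
  · linarith
  · rw [interior_Icc] at ht
    have hder : deriv (fun t => -Real.cos t) t = Real.sin t := by simp
    rw [hder]
    have h1 : Real.cos t ≤ d :=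
      (Real.cos_le_cos_of_nonneg_of_le_pi hθ (by linarith [ht.2]) ht.1.le).trans hd
    have h2 : 0 ≤ Real.cos t :=
      h0.trans (Real.cos_le_cos_of_nonneg_of_le_pi (by linarith [ht.1]) hφ ht.2.le)
    have h3 : 0 ≤ Real.sin t :=
      Real.sin_nonneg_of_nonneg_of_le_pi (by linarith [ht.1]) (by linarith [ht.2])
    nlinarith [Real.sin_sq_add_cos_sq t, Real.sin_le_one t]

lemma abs_chebyshevKernel_le_of_le_abs_sub (m : ℕ) {φ θ d : ℝ} (hφ : |Real.cos φ| ≤ 1 / 2)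
    (hφ0 : φ ∈ Icc 0 Real.pi) (hθ : θ ∈ Icc 0 Real.pi) (hd : 0 < d)
    (h : d ≤ |Real.cos φ - Real.cos θ|) :
    |2 * Real.pi * (chebyshevKernel m (Real.cos φ)).eval (Real.cos θ)| ≤ Real.pi / d + 2 := by
  have hπ := Real.pi_pos
  have h1 := abs_chebyshevKernel_sub_le m hφ hφ0 hθ
  have h2 : |dirichletSum m (φ - θ)| ≤ Real.pi / d := by
    have h3 := abs_dirichletSum_mul_abs_sin_le m (φ - θ)
    have h4 : d ≤ |φ - θ| := h.trans (Real.abs_cos_sub_cos_le _ _)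
    have h5 : 2 / Real.pi * |(φ - θ) / 2| ≤ |Real.sin ((φ - θ) / 2)| := by
      refine Real.mul_abs_le_abs_sin ?_
      rw [abs_le]; constructor <;> linarith [hφ0.1, hφ0.2, hθ.1, hθ.2]
    have h6 : d / Real.pi ≤ |Real.sin ((φ - θ) / 2)| := by
      refine le_trans ?_ h5
      rw [abs_div, abs_two, div_mul_div_comm, mul_comm Real.pi, mul_div_mul_left _ _ two_ne_zero]
      gcongr
    rw [le_div_iff₀ hd]
    have h7 : |dirichletSum m (φ - θ)| * (d / Real.pi) ≤ 1 :=
      (mul_le_mul_of_nonneg_left h6 (abs_nonneg _)).trans h3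
    rw [mul_div_assoc', div_le_one hπ] at h7
    exact h7
  have h8 := abs_add_le (2 * Real.pi * (chebyshevKernel m (Real.cos φ)).eval (Real.cos θ)
      - dirichletSum m (φ - θ)) (dirichletSum m (φ - θ))
  rw [sub_add_cancel] at h8
  linarith

lemma abs_chebyshevKernel_le (m : ℕ) {φ θ : ℝ} (hφ : |Real.cos φ| ≤ 1 / 2)
    (hφ0 : φ ∈ Icc 0 Real.pi) (hθ : θ ∈ Icc 0 Real.pi) :
    |2 * Real.pi * (chebyshevKernel m (Real.cos φ)).eval (Real.cos θ)| ≤ 2 * m + 3 := by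
  have h1 := abs_chebyshevKernel_sub_le m hφ hφ0 hθ
  have h2 := abs_dirichletSum_le m (φ - θ)
  have h8 := abs_add_le (2 * Real.pi * (chebyshevKernel m (Real.cos φ)).eval (Real.cos θ)
      - dirichletSum m (φ - θ)) (dirichletSum m (φ - θ))
  rw [sub_add_cancel] at h8
  linarith

lemma le_chebyshevKernel_self (m : ℕ) {φ : ℝ} (hφ : |Real.cos φ| ≤ 1 / 2)
    (hφ0 : φ ∈ Icc 0 Real.pi) :
    2 * m - 1 ≤ 2 * Real.pi * (chebyshevKernel m (Real.cos φ)).eval (Real.cos φ) := by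
  have h1 := abs_chebyshevKernel_sub_le m hφ hφ0 hφ0
  rw [sub_self, dirichletSum_zero] at h1
  linarith [(abs_le.1 h1).1]

lemma le_dirichletSum_of_small (m : ℕ) {u : ℝ} (hu : (m : ℝ) * |u| ≤ 1 / 2) :
    1 + 7 / 4 * m ≤ dirichletSum m u := by
  have h : ∑ k ∈ Finset.range m, (7 / 8 : ℝ) ≤
      ∑ k ∈ Finset.range m, Real.cos ((k + 1 : ℝ) * u) := by
    refine Finset.sum_le_sum fun k hk => ?_
    have hkm : ((k + 1 : ℕ) : ℝ) ≤ m := by exact_mod_cast Finset.mem_range.1 hk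
    push_cast at hkm
    have h1 : |(k + 1 : ℝ) * u| ≤ 1 / 2 := by
      rw [abs_mul, abs_of_nonneg (by positivity : (0 : ℝ) ≤ k + 1)]
      exact (mul_le_mul_of_nonneg_right hkm (abs_nonneg u)).trans hu
    have h2 := Real.one_sub_sq_div_two_le_cos (x := (k + 1 : ℝ) * u)
    have h3 : ((k + 1 : ℝ) * u) ^ 2 ≤ (1 / 2) ^ 2 := sq_le_sq.2 (by
      rwa [abs_of_pos (by norm_num : (0 : ℝ) < 1 / 2)])
    linarith
  simp only [Finset.sum_const, Finset.card_range, nsmul_eq_mul] at h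
  unfold dirichletSum
  linarith

set_option maxHeartbeats 800000 in
/-- Polynomials of small degree, equal to `1` at a point `x` close to the origin on its right, which
make the weights `v` and `W * chebyshevWeight` comparable. -/
lemma IsRegularRight.exists_peak (hv : IsRegularRight v k B W) {ε : ℝ} (hε : 0 < ε)
    (hε' : ε ≤ 1 / 8) :
    ∃ M > 0, ∃ δ > 0, δ ≤ 1 / 4 ∧ ∀ᶠ n : ℕ in atTop, ∀ φ ∈ Icc 0 Real.pi,
      M / n ≤ Real.cos φ → Real.cos φ ≤ δ → ∃ q : ℝ[X], (q.natDegree : ℝ) ≤ ε * n ∧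
        q.eval (Real.cos φ) = 1 ∧
        (∀ y ∈ Ioo (-1 : ℝ) 1, q.eval y ^ 2 * v y ≤ (1 + ε) * W * chebyshevWeight y) ∧
        (∀ y ∈ Ioo (-1 : ℝ) 1, q.eval y ^ 2 * (W * chebyshevWeight y) ≤ (1 + ε) * v y) ∧
        ∀ θ ∈ Icc 0 Real.pi, |φ - θ| ≤ 5 / n → 1 / 2 ≤ q.eval (Real.cos θ) := by
  have hπ := Real.pi_pos
  have hB := hv.const_pos
  have hW := hv.limit_pos
  obtain ⟨η, hη, hη1, hη2⟩ : ∃ η > 0, η ^ 2 * (2 * B) ≤ W ∧ η ^ 2 * (2 * (B * W)) ≤ 1 := by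
    refine ⟨√(min (W / (2 * B)) (1 / (2 * (B * W)))), by positivity, ?_, ?_⟩
    · rw [Real.sq_sqrt (by positivity), ← le_div_iff₀ (by positivity)]; exact min_le_left _ _
    · rw [Real.sq_sqrt (by positivity), ← le_div_iff₀ (by positivity)]; exact min_le_right _ _
  obtain ⟨δ₀, hδ₀, hδ₀v⟩ : ∃ δ₀ > 0, ∀ y, 0 < y → y < δ₀ →
      v y ≤ (1 + ε / 8) * W ∧ W ≤ (1 + ε / 8) * v y := by
    have h1 : ∀ᶠ y in nhdsWithin (0 : ℝ) (Ioi 0), v y ≤ (1 + ε / 8) * W :=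
      hv.tendsto.eventually_le_const (by nlinarith)
    have h2 : ∀ᶠ y in nhdsWithin (0 : ℝ) (Ioi 0), W / (1 + ε / 8) ≤ v y := by
      refine hv.tendsto.eventually_const_le ?_
      rw [div_lt_iff₀ (by positivity)]; nlinarith
    obtain ⟨d, hd, h⟩ := (nhdsGT_basis (0 : ℝ)).eventually_iff.1 (h1.and h2)
    refine ⟨d, hd, fun y h0 hy => ?_⟩
    obtain ⟨ha, hb⟩ := h ⟨h0, hy⟩
    rw [div_le_iff₀ (by positivity)] at hb
    exact ⟨ha, by linarith⟩
  obtain ⟨δ, hδ, hδ4, hδδ₀, hδk⟩ : ∃ δ > 0, δ ≤ 1 / 4 ∧ 2 * δ ≤ δ₀ ∧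
      (2 * k + 1) * (2 * δ) ^ 2 ≤ ε / 16 := by
    refine ⟨min (1 / 4) (min (δ₀ / 2) (ε / (64 * (2 * k + 1)))), by positivity, min_le_left _ _,
      ?_, ?_⟩
    · have := (min_le_right (1 / 4 : ℝ) _).trans (min_le_left (δ₀ / 2) (ε / (64 * (2 * k + 1))))
      linarith
    · have h1 := (min_le_right (1 / 4 : ℝ) _).trans (min_le_right (δ₀ / 2) (ε / (64 * (2 * k + 1))))
      have h2 := min_le_left (1 / 4 : ℝ) (min (δ₀ / 2) (ε / (64 * (2 * k + 1))))
      set δ := min (1 / 4 : ℝ) (min (δ₀ / 2) (ε / (64 * (2 * k + 1))))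
      have h0 : 0 < δ := by positivity
      rw [le_div_iff₀ (by positivity)] at h1
      have hk0 : (0 : ℝ) ≤ k := by positivity
      nlinarith [mul_nonneg hk0 h0.le]
  refine ⟨4 * Real.pi / (η * ε), by positivity, δ, hδ, hδ4, ?_⟩
  set M := 4 * Real.pi / (η * ε) with hM
  have hM0 : 0 < M := by positivity
  have hlarge : ∀ A : ℝ, ∀ᶠ n : ℕ in atTop, A ≤ n := fun A =>
    tendsto_natCast_atTop_atTop.eventually_ge_atTop A
  filter_upwards [hlarge (200 / ε / ε), hlarge (4 * k / ε), hlarge M, hlarge (M / δ),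
    hlarge (5 / δ), hlarge 1] with n hn1 hn2 hn3 hn4 hn5 hn6 φ hφ hφM hφδ
  have hn0 : (0 : ℝ) < n := by linarith
  rw [div_le_iff₀ hε] at hn1 hn2
  rw [div_le_iff₀ hε] at hn1
  rw [div_le_iff₀ hδ] at hn4 hn5
  set x := Real.cos φ with hx
  have hx0 : 0 < x := lt_of_lt_of_le (by positivity) hφM
  have hxabs : |x| ≤ 1 / 2 := by rw [abs_of_pos hx0]; linarith
  set m := ⌊ε * n / 2⌋₊ with hm
  have hm1 : (m : ℝ) ≤ ε * n / 2 := Nat.floor_le (by positivity)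
  have hm2 : ε * n / 2 < m + 1 := Nat.lt_floor_add_one _
  set s : ℝ := 2 * m - 1 with hs
  have hs1 : 100 ≤ ε * s := by nlinarith only [hn1, hm2, hs, hε, hε']
  have hs100 : 800 ≤ s := by nlinarith only [hs1, hε, hε']
  have hs2 : ε * n / 2 ≤ s := by nlinarith only [hs1, hs100, hm2, hs, hε, hε']
  set K := chebyshevKernel m x with hK
  have hKx : s ≤ 2 * Real.pi * K.eval x := le_chebyshevKernel_self m hxabs hφ
  have hKx' : 2 * Real.pi * K.eval x ≤ s + 4 :=
    (le_abs_self _).trans ((abs_chebyshevKernel_le m hxabs hφ hφ).trans (by rw [hs]; linarith))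
  set a := 2 * Real.pi * K.eval x with ha
  have ha0 : 0 < a := by linarith
  have hber : ∀ y : ℝ, 0 ≤ y → y ≤ 2 * δ → 1 - ε / 16 ≤ (1 - y ^ 2) ^ k ∧
      1 - ε / 16 ≤ ((1 - y ^ 2) ^ k) ^ 2 := by
    intro y hy0 hy
    have hy2 : y ^ 2 ≤ (2 * δ) ^ 2 := by gcongr
    have hk0 : (0 : ℝ) ≤ k := by positivity
    have h4 : (2 * δ) ^ 2 ≤ 1 := by nlinarith only [hδ, hδ4]
    have h1 := one_add_mul_le_pow (a := -y ^ 2) (by linarith only [hy2, h4]) k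
    have h2 := one_add_mul_le_pow (a := -y ^ 2) (by linarith only [hy2, h4]) (k * 2)
    rw [← sub_eq_add_neg] at h1 h2
    rw [← pow_mul]
    push_cast at h2
    constructor
    · nlinarith only [h1, h2, hy2, hδk, mul_le_mul_of_nonneg_left hy2 hk0, mul_nonneg hk0 (sq_nonneg (2 * δ))]
    · nlinarith only [h1, h2, hy2, hδk, mul_le_mul_of_nonneg_left hy2 hk0, mul_nonneg hk0 (sq_nonneg (2 * δ))]
  set b := (1 - x ^ 2) ^ k with hb
  obtain ⟨hb1, hb2⟩ := hber x hx0.le (by linarith)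
  rw [← hb] at hb1 hb2
  have hbpos : 0 < b := by linarith
  have hble : b ≤ 1 := pow_le_one₀ (by nlinarith only [hx0, hφδ, hδ4]) (by nlinarith only [hx0])
  clear_value a b s m M
  refine ⟨C (2 * Real.pi / (a * b)) * (K * (1 - X ^ 2) ^ k), ?_, ?_, ?_⟩
  · have h1 : (C (2 * Real.pi / (a * b)) * (K * (1 - X ^ 2) ^ k)).natDegree ≤ m + k * 2 := by
      refine (natDegree_C_mul_le _ _).trans (natDegree_mul_le.trans ?_)
      refine add_le_add (natDegree_chebyshevKernel_le _ _) (natDegree_pow_le.trans ?_)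
      refine Nat.mul_le_mul_left _ ?_
      compute_degree
    have h2 : ((C (2 * Real.pi / (a * b)) * (K * (1 - X ^ 2) ^ k)).natDegree : ℝ) ≤ m + k * 2 := by
      exact_mod_cast h1
    linarith
  · simp only [eval_mul, eval_C, eval_pow, eval_sub, eval_one, eval_X]
    rw [← hb, div_mul_eq_mul_div, div_eq_one_iff_eq (by positivity), ha]
    ring
  have heval : ∀ y, (C (2 * Real.pi / (a * b)) * (K * (1 - X ^ 2) ^ k)).eval y
      = (2 * Real.pi * K.eval y) / a * ((1 - y ^ 2) ^ k / b) := by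
    intro y
    simp only [eval_mul, eval_C, eval_pow, eval_sub, eval_one, eval_X]
    field_simp
  have hcomp : ∀ y ∈ Ioo (-1 : ℝ) 1,
      (((2 * Real.pi * K.eval y) / a) ^ 2 ≤ η ^ 2) ∨
      (0 < y ∧ y ≤ 2 * δ ∧ y < δ₀ ∧ ((2 * Real.pi * K.eval y) / a) ^ 2 ≤ 1 + ε / 8) := by
    intro y hy
    have hθ : Real.arccos y ∈ Icc 0 Real.pi := ⟨Real.arccos_nonneg y, Real.arccos_le_pi y⟩
    have hcos : Real.cos (Real.arccos y) = y := Real.cos_arccos hy.1.le hy.2.le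
    by_cases hfar : M / n ≤ |x - y|
    · left
      have h1 := abs_chebyshevKernel_le_of_le_abs_sub m (d := M / n) hxabs hφ hθ (by positivity)
        (by rw [hcos]; exact hfar)
      rw [hcos] at h1
      refine sq_le_sq.2 ?_
      rw [abs_of_pos hη, abs_div, abs_of_pos ha0, div_le_iff₀ ha0]
      have h2 : Real.pi / (M / n) = η * ε * n / 4 := by rw [hM]; field_simp
      have h3 : M * (η * ε) = 4 * Real.pi := by rw [hM]; field_simp
      have h4 : 2 ≤ η * ε * n / 4 := by
        have := mul_le_mul_of_nonneg_left hn3 (by positivity : 0 ≤ η * ε)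
        nlinarith only [this, h3, Real.pi_gt_three]
      rw [h2] at h1
      nlinarith only [h1, h4, hs2, hη, hε, mul_le_mul_of_nonneg_left hKx hη.le, mul_le_mul_of_nonneg_left hs2 hη.le]
    · right
      push Not at hfar
      have hMδ : M / n ≤ δ := by rw [div_le_iff₀ hn0]; linarith
      obtain ⟨h1, h2⟩ := abs_lt.1 hfar
      refine ⟨by linarith, by linarith, by linarith, ?_⟩
      have h3 := abs_chebyshevKernel_le m hxabs hφ hθ
      rw [hcos] at h3
      have h4 : |2 * Real.pi * K.eval y| ≤ s + 4 := by rw [hs]; linarith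
      rw [div_pow, div_le_iff₀ (by positivity)]
      have h5 : (2 * Real.pi * K.eval y) ^ 2 ≤ (s + 4) ^ 2 :=
        sq_le_sq.2 (by rwa [abs_of_pos (by linarith : 0 < s + 4)])
      have h6 : s ^ 2 ≤ a ^ 2 := by gcongr
      refine h5.trans (le_trans ?_ (mul_le_mul_of_nonneg_left h6 (by positivity)))
      nlinarith only [hs1, hs100, hε, hε']
  have hfin : (1 + ε / 8) ^ 4 ≤ 1 + ε := by
    have h1 : (1 + ε / 8) ^ 2 ≤ 1 + ε / 2 - ε / 8 := by nlinarith only [hε, hε']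
    calc (1 + ε / 8) ^ 4 = ((1 + ε / 8) ^ 2) ^ 2 := by ring
      _ ≤ (1 + ε / 2 - ε / 8) ^ 2 := by gcongr
      _ ≤ 1 + ε := by nlinarith only [hε, hε']
  have hω1 : ∀ y ∈ Ioo (-1 : ℝ) 1, 0 < y → y ≤ 2 * δ → chebyshevWeight y ≤ 1 + ε / 8 := by
    intro y hy hy0 hyδ
    unfold chebyshevWeight
    rw [Real.sqrt_le_left (by positivity)]
    have hy2 : y ^ 2 ≤ (2 * δ) ^ 2 := by gcongr
    have hk0 : (0 : ℝ) ≤ k := by positivity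
    have : 1 - ε / 16 ≤ 1 - y ^ 2 := by nlinarith only [hy2, hδk, mul_nonneg hk0 (sq_nonneg (2 * δ))]
    rw [inv_le_comm₀ (by linarith) (by positivity)]
    refine le_trans ?_ this
    rw [inv_le_comm₀ (by positivity) (by linarith), inv_le_iff_one_le_mul₀ (by linarith)]
    nlinarith only [hε, hε', mul_pos hε hε, mul_nonneg (mul_pos hε hε).le (sub_nonneg.2 hε')]
  have hbinv : 1 / b ^ 2 ≤ 1 + ε / 8 := by
    rw [div_le_iff₀ (by positivity)]; nlinarith only [hb2, hε, hε']
  refine ⟨fun y hy => ?_, fun y hy => ?_, fun θ hθ hnear => ?_⟩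
  · have hvy := hv.pos y hy
    have hω := one_le_chebyshevWeight hy
    rw [heval, mul_pow, div_pow (_ ^ k)]
    rcases hcomp y hy with h | ⟨h0, h1, h2, h3⟩
    · calc _ = ((2 * Real.pi * K.eval y) / a) ^ 2 * (((1 - y ^ 2) ^ k) ^ 2 * v y) * (1 / b ^ 2) := by
            ring
        _ ≤ η ^ 2 * B * 2 := by
            gcongr
            · exact hv.upper y hy
            · linarith
        _ ≤ W := by linarith
        _ ≤ (1 + ε) * W * 1 := by nlinarith only [hε, hW]
        _ ≤ _ := by gcongr
    · have hr : ((1 - y ^ 2) ^ k) ^ 2 ≤ 1 := by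
        rw [← pow_mul]; exact pow_le_one₀ (by nlinarith only [hy.1, hy.2]) (by nlinarith only [hy.1, hy.2])
      calc _ = ((2 * Real.pi * K.eval y) / a) ^ 2 * ((1 - y ^ 2) ^ k) ^ 2 * v y * (1 / b ^ 2) := by
            ring
        _ ≤ (1 + ε / 8) * 1 * ((1 + ε / 8) * W) * (1 + ε / 8) := by
            gcongr
            exact (hδ₀v y h0 h2).1
        _ ≤ (1 + ε / 8) ^ 4 * W * 1 := by
            nlinarith only [hε, hW, pow_pos (by positivity : 0 < 1 + ε / 8) 3,
              mul_pos (pow_pos (by positivity : 0 < 1 + ε / 8) 3) hW]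
        _ ≤ _ := by gcongr
  · have hvy := hv.pos y hy
    have hω := one_le_chebyshevWeight hy
    rw [heval, mul_pow, div_pow (_ ^ k)]
    rcases hcomp y hy with h | ⟨h0, h1, h2, h3⟩
    · calc _ = ((2 * Real.pi * K.eval y) / a) ^ 2 * (((1 - y ^ 2) ^ k) ^ 2 * chebyshevWeight y)
              * (1 / b ^ 2) * W := by ring
        _ ≤ η ^ 2 * (B * v y) * 2 * W := by
            have hl := hv.lower y hy
            have hb' : 1 / b ^ 2 ≤ 2 := by linarith
            have hB0 : 0 ≤ B * v y := by positivity
            refine mul_le_mul_of_nonneg_right ?_ hW.le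
            refine mul_le_mul ?_ hb' (by positivity) (by positivity)
            exact mul_le_mul h hl (by positivity) (by positivity)
        _ = η ^ 2 * (2 * (B * W)) * v y := by ring
        _ ≤ (1 + ε) * v y := by
            gcongr
            linarith
    · have hr : ((1 - y ^ 2) ^ k) ^ 2 ≤ 1 := by
        rw [← pow_mul]; exact pow_le_one₀ (by nlinarith only [hy.1, hy.2]) (by nlinarith only [hy.1, hy.2])
      calc _ = ((2 * Real.pi * K.eval y) / a) ^ 2 * ((1 - y ^ 2) ^ k) ^ 2
              * (W * chebyshevWeight y) * (1 / b ^ 2) := by ring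
        _ ≤ (1 + ε / 8) * 1 * (((1 + ε / 8) * v y) * (1 + ε / 8)) * (1 + ε / 8) := by
            refine mul_le_mul ?_ hbinv (by positivity) (by positivity)
            refine mul_le_mul ?_ ?_ (by positivity) (by positivity)
            · exact mul_le_mul h3 hr (by positivity) (by positivity)
            · exact mul_le_mul (hδ₀v y h0 h2).2 (hω1 y hy h0 h1) (by positivity) (by positivity)
        _ = (1 + ε / 8) ^ 4 * v y := by ring
        _ ≤ _ := by gcongr
  · rw [heval]
    have h1 := abs_chebyshevKernel_sub_le m hxabs hφ hθ
    have h2 : 1 + 7 / 4 * m ≤ dirichletSum m (φ - θ) := by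
      refine le_dirichletSum_of_small m ?_
      calc (m : ℝ) * |φ - θ| ≤ (ε * n / 2) * (5 / n) := by gcongr
        _ = 5 / 2 * ε := by field_simp
        _ ≤ 1 / 2 := by linarith
    have h3 : 7 / 4 * m - 1 ≤ 2 * Real.pi * K.eval (Real.cos θ) := by
      linarith [(abs_le.1 h1).1]
    have h4 : 3 / 4 ≤ 2 * Real.pi * K.eval (Real.cos θ) / a := by
      rw [le_div_iff₀ ha0]; linarith
    have h5 : |x - Real.cos θ| ≤ δ := by
      refine (Real.abs_cos_sub_cos_le _ _).trans (hnear.trans ?_)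
      rw [div_le_iff₀ hn0]; linarith
    have h6 : 1 - ε / 16 ≤ (1 - Real.cos θ ^ 2) ^ k := by
      have := (hber |Real.cos θ| (abs_nonneg _) ?_).1
      · rwa [sq_abs] at this
      · obtain ⟨ha, hb⟩ := abs_le.1 h5
        rw [abs_le]; constructor <;> linarith
    have h7 : 3 / 4 ≤ (1 - Real.cos θ ^ 2) ^ k / b := by
      rw [le_div_iff₀ hbpos]; linarith
    nlinarith only [h4, h7]

end Peak

section Approximation

variable {v : ℝ → ℝ} {k : ℕ} {B W : ℝ}

lemma eval_sq_le_of_peak (hv : IntervalIntegrable v volume (-1) 1) (hW : 0 < W) {ε : ℝ}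
    (hε : 0 < ε) (hε' : ε ≤ 1 / 8) {n : ℕ} (hn : 3 ≤ ε * n) {φ : ℝ} (hφ : φ ∈ Icc 0 Real.pi)
    (hφ2 : |Real.cos φ| ≤ 1 / 2) {q : ℝ[X]} (hq : (q.natDegree : ℝ) ≤ ε * n)
    (hq1 : q.eval (Real.cos φ) = 1)
    (hqv : ∀ y ∈ Ioo (-1 : ℝ) 1, q.eval y ^ 2 * (W * chebyshevWeight y) ≤ (1 + ε) * v y)
    (hpos : ∀ y ∈ Ioo (-1 : ℝ) 1, 0 < v y)
    {p : ℝ[X]} (hp : p.natDegree ≤ n) :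
    p.eval (Real.cos φ) ^ 2 ≤ (1 + 4 * ε) * (n / (Real.pi * W)) * weightIntegral v (p ^ 2) := by
  have hπ := Real.pi_pos
  set N := n + q.natDegree with hN
  have hdeg : (p * q).natDegree ≤ N := natDegree_mul_le.trans (by omega)
  have h1 := eval_sq_le_chebyshevKernel (Real.cos φ) hdeg
  have h2 : 2 * Real.pi * (chebyshevKernel N (Real.cos φ)).eval (Real.cos φ) ≤ 2 * N + 3 :=
    (le_abs_self _).trans (abs_chebyshevKernel_le N hφ2 hφ hφ)
  have h3 : weightIntegral chebyshevWeight ((p * q) ^ 2) ≤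
      (1 + ε) / W * weightIntegral v (p ^ 2) := by
    rw [← weightIntegral_C_mul]
    refine weightIntegral_mono intervalIntegrable_chebyshevWeight hv fun y hy => ?_
    simp only [eval_mul, eval_pow, eval_C]
    have := mul_le_mul_of_nonneg_left (hqv y hy) (sq_nonneg (p.eval y))
    rw [div_mul_eq_mul_div, div_mul_eq_mul_div, le_div_iff₀ hW]
    linarith
  have h4 : 0 ≤ weightIntegral v (p ^ 2) :=
    weightIntegral_nonneg hpos fun y _ => by simpa using sq_nonneg _
  have h5 : 0 ≤ weightIntegral chebyshevWeight ((p * q) ^ 2) :=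
    weightIntegral_nonneg (fun y hy => chebyshevWeight_pos hy) fun y _ => by
      rw [eval_pow]; exact sq_nonneg _
  rw [eval_mul, hq1, mul_one] at h1
  have hNn : (N : ℝ) ≤ n + ε * n := by rw [hN]; push_cast; linarith
  have h6 : (chebyshevKernel N (Real.cos φ)).eval (Real.cos φ) ≤ (n * (1 + 3 / 2 * ε)) / Real.pi := by
    rw [le_div_iff₀ hπ]; linarith
  calc p.eval (Real.cos φ) ^ 2 ≤ _ := h1
    _ ≤ (n * (1 + 3 / 2 * ε)) / Real.pi * ((1 + ε) / W * weightIntegral v (p ^ 2)) := by gcongr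
    _ = (1 + 3 / 2 * ε) * (1 + ε) * (n / (Real.pi * W)) * weightIntegral v (p ^ 2) := by
        field_simp
    _ ≤ _ := by
        gcongr
        nlinarith

/-- A kernel reproducing the value at `cos φ` is close to an explicit one. -/
lemma kernel_sub_sq_le_of_peak (hv : IntervalIntegrable v volume (-1) 1) (hW : 0 < W) {ε : ℝ}
    (hε : 0 < ε) (hε' : ε ≤ 1 / 8) {n : ℕ} (hn : 3 ≤ ε * n) {φ : ℝ} (hφ : φ ∈ Icc 0 Real.pi)
    (hφ2 : |Real.cos φ| ≤ 1 / 2) {q : ℝ[X]} (hq : (q.natDegree : ℝ) ≤ ε * n)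
    (hq1 : q.eval (Real.cos φ) = 1)
    (hqv : ∀ y ∈ Ioo (-1 : ℝ) 1, q.eval y ^ 2 * v y ≤ (1 + ε) * W * chebyshevWeight y)
    (hup : ∀ p : ℝ[X], p.natDegree ≤ n → p.eval (Real.cos φ) ^ 2 ≤
      (1 + 4 * ε) * (n / (Real.pi * W)) * weightIntegral v (p ^ 2))
    {κ : ℝ[X]} (hκ : κ.degree < n)
    (hrep : ∀ p : ℝ[X], p.degree < n → weightIntegral v (κ * p) = p.eval (Real.cos φ))
    (hκpos : 0 < κ.eval (Real.cos φ)) {y : ℝ}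
    (hupy : ∀ p : ℝ[X], p.natDegree ≤ n → p.eval y ^ 2 ≤
      (1 + 4 * ε) * (n / (Real.pi * W)) * weightIntegral v (p ^ 2)) :
    (κ.eval y - 1 / W * ((chebyshevKernel (n - 1 - q.natDegree) (Real.cos φ)).eval y
      * q.eval y)) ^ 2 ≤ 14 * ε * (n / (Real.pi * W)) ^ 2 := by
  have hπ := Real.pi_pos
  have hnat : ∀ p : ℝ[X], p.degree < n → p.natDegree ≤ n := fun p hp =>
    natDegree_le_of_degree_le hp.le
  have hn0 : (0 : ℝ) < n := by
    rcases Nat.eq_zero_or_pos n with h | h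
    · subst h; norm_num at hn
    · exact_mod_cast h
  have hn24 : (24 : ℝ) ≤ n := by nlinarith
  have hqn : q.natDegree + 1 ≤ n := by
    have : (q.natDegree : ℝ) + 1 ≤ n := by nlinarith
    exact_mod_cast this
  set m := n - 1 - q.natDegree with hm
  have hmn : m + q.natDegree + 1 = n := by omega
  have hmR : (m : ℝ) + q.natDegree + 1 = n := by exact_mod_cast hmn
  set ξ := Real.cos φ with hξ
  set K := chebyshevKernel m ξ with hK
  set g : ℝ[X] := C (1 / W) * (K * q) with hg
  have hgdeg : g.degree < n := by
    have : g.natDegree ≤ m + q.natDegree :=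
      (natDegree_C_mul_le _ _).trans (natDegree_mul_le.trans
        (add_le_add (natDegree_chebyshevKernel_le _ _) le_rfl))
    refine degree_le_natDegree.trans_lt ?_
    exact_mod_cast this.trans_lt (by omega : m + q.natDegree < n)
  have hκκ : weightIntegral v (κ * κ) = κ.eval ξ := hrep κ hκ
  have hκg : weightIntegral v (κ * g) = K.eval ξ / W := by
    rw [hrep g hgdeg, hg]; simp [hq1]; ring
  have hKK : weightIntegral chebyshevWeight (K * K) = K.eval ξ :=
    weightIntegral_chebyshevKernel_mul ξ (natDegree_chebyshevKernel_le _ _)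
  have hgg : weightIntegral v (g * g) ≤ (1 + ε) / W * K.eval ξ := by
    rw [← hKK, ← weightIntegral_C_mul]
    refine weightIntegral_mono hv intervalIntegrable_chebyshevWeight fun z hz => ?_
    simp only [hg, eval_mul, eval_C]
    have := mul_le_mul_of_nonneg_left (hqv z hz) (sq_nonneg (K.eval z / W))
    calc _ = (K.eval z / W) ^ 2 * (q.eval z ^ 2 * v z) := by ring
      _ ≤ _ := this
      _ = _ := by field_simp
  have hKξ : (1 - 3 / 2 * ε) * (n / Real.pi) ≤ K.eval ξ := by
    have h1 : 2 * m - 1 ≤ 2 * Real.pi * K.eval ξ := le_chebyshevKernel_self m hφ2 hφ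
    rw [mul_div_assoc', div_le_iff₀ hπ]
    nlinarith
  have hκξ : κ.eval ξ ≤ (1 + 4 * ε) * (n / (Real.pi * W)) := by
    have h1 := hup κ (hnat κ hκ)
    rw [sq κ, hκκ] at h1
    refine le_of_mul_le_mul_right ?_ hκpos
    linarith
  have hsq : weightIntegral v ((κ - g) ^ 2) ≤ 7 * ε * (n / (Real.pi * W)) := by
    have h1 : (κ - g) ^ 2 = κ * κ - C 2 * (κ * g) + g * g := by
      have : (C 2 : ℝ[X]) = 2 := rfl
      rw [this]; ring
    rw [h1, weightIntegral_add hv, weightIntegral_sub hv, weightIntegral_C_mul, hκκ, hκg]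
    have h2 : (1 - 3 / 2 * ε) * (n / (Real.pi * W)) ≤ K.eval ξ / W := by
      rw [← div_div, mul_div_assoc']
      gcongr
    have h3 : (1 + ε) / W * K.eval ξ = (1 + ε) * (K.eval ξ / W) := by ring
    rw [h3] at hgg
    have h4 : 0 < n / (Real.pi * W) := by positivity
    have h5 := mul_le_mul_of_nonneg_left h2 (by linarith : 0 ≤ 1 - ε)
    nlinarith [mul_pos hε h4, mul_pos hε (mul_pos hε h4)]
  have hfin := hupy (κ - g) ((natDegree_sub_le _ _).trans (max_le (hnat _ hκ) (hnat _ hgdeg)))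
  have he : (κ - g).eval y = κ.eval y - 1 / W * (K.eval y * q.eval y) := by simp [hg]
  rw [he] at hfin
  refine hfin.trans ?_
  have h4 : 0 < n / (Real.pi * W) := by positivity
  calc _ ≤ (1 + 4 * ε) * (n / (Real.pi * W)) * (7 * ε * (n / (Real.pi * W))) := by gcongr
    _ = (1 + 4 * ε) * (7 * ε) * (n / (Real.pi * W)) ^ 2 := by ring
    _ ≤ _ := mul_le_mul_of_nonneg_right (by nlinarith only [hε, hε']) (sq_nonneg _)

/-- Positivity of the Dirichlet sum before its first zero. -/
lemma le_dirichletSum {m : ℕ} {e u : ℝ} (he : 0 < e) (he1 : e < 1) (hu : 0 ≤ u)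
    (hu' : (m + 1 / 2) * u ≤ Real.pi - e) :
    4 * e / Real.pi ^ 2 * (m + 1 / 2) ≤ dirichletSum m u := by
  have hπ := Real.pi_gt_three
  have hm : (0 : ℝ) ≤ m := by positivity
  rcases hu.eq_or_lt with rfl | hu0
  · rw [dirichletSum_zero, div_mul_eq_mul_div, div_le_iff₀ (by positivity)]
    nlinarith [mul_nonneg hm (by nlinarith : 0 ≤ Real.pi ^ 2 - 9)]
  have hsin : 0 < Real.sin (u / 2) :=
    Real.sin_pos_of_pos_of_lt_pi (by positivity) (by nlinarith)
  have hle : Real.sin (u / 2) ≤ u / 2 := Real.sin_le (by positivity)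
  have hD := dirichletSum_mul_sin m u
  set a := (m + 1 / 2) * u with ha
  have ha0 : 0 < a := by positivity
  have hsa : 2 * e / Real.pi ^ 2 * a ≤ Real.sin a := by
    have hval : 2 * e / Real.pi ^ 2 * a = 2 / Real.pi * (e / Real.pi * a) := by field_simp
    rw [hval]
    rcases le_total a (Real.pi / 2) with h | h
    · refine le_trans ?_ (Real.mul_le_sin ha0.le h)
      gcongr
      rw [div_mul_eq_mul_div, div_le_iff₀ (by positivity)]
      nlinarith
    · rw [← Real.sin_pi_sub]
      refine le_trans ?_ (Real.mul_le_sin (x := Real.pi - a) (by linarith) (by linarith))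
      gcongr
      rw [div_mul_eq_mul_div, div_le_iff₀ (by positivity)]
      nlinarith
  have hD0 : 0 ≤ dirichletSum m u := by
    refine nonneg_of_mul_nonneg_left ?_ hsin
    rw [hD]
    exact le_trans (by positivity) hsa
  have h1 : 2 * e / Real.pi ^ 2 * a ≤ dirichletSum m u * (u / 2) := by
    rw [← hD] at hsa
    exact hsa.trans (mul_le_mul_of_nonneg_left hle hD0)
  refine le_of_mul_le_mul_right ?_ (by positivity : 0 < u / 2)
  refine le_trans (le_of_eq ?_) h1
  rw [ha]; ring

/-- Negativity of the Dirichlet sum after its first zero. -/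
lemma dirichletSum_le_neg {m : ℕ} {e u : ℝ} (he : 0 < e) (he1 : e < 1) (hu1 : u ≤ 1)
    (hu0 : 0 < u) (hu : Real.pi + e / 2 ≤ (m + 1 / 2) * u) (hu' : (m + 1 / 2) * u ≤ Real.pi + e) :
    dirichletSum m u ≤ - (2 * e / (Real.pi * u)) := by
  have hπ := Real.pi_gt_three
  have hsin : 0 < Real.sin (u / 2) :=
    Real.sin_pos_of_pos_of_lt_pi (by positivity) (by nlinarith)
  have hle : Real.sin (u / 2) ≤ u / 2 := Real.sin_le (by positivity)
  have hD := dirichletSum_mul_sin m u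
  set a := (m + 1 / 2) * u with ha
  have h1 : Real.sin a ≤ - (e / Real.pi) := by
    have h2 := Real.mul_le_sin (x := a - Real.pi) (by linarith) (by linarith)
    rw [Real.sin_sub_pi] at h2
    have h3 : e / Real.pi ≤ 2 / Real.pi * (a - Real.pi) := by
      rw [div_mul_eq_mul_div]
      gcongr
      linarith
    linarith
  have hD0 : 0 < -dirichletSum m u := by
    refine pos_of_mul_pos_left ?_ hsin.le
    have : 0 < e / Real.pi := by positivity
    linarith
  have h2 := mul_le_mul_of_nonneg_left hle hD0.le
  have h3 : e / Real.pi ≤ -dirichletSum m u * (u / 2) := by linarith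
  rw [div_le_iff₀ (by positivity)] at h3
  have h4 : 2 * e / (Real.pi * u) ≤ -dirichletSum m u := by
    rw [div_le_iff₀ (by positivity)]
    linarith
  linarith

end Approximation

section LocalSpacing

variable {v : ℝ → ℝ} {k : ℕ} {B W : ℝ}

lemma pos_of_sub_sq_le {x g e A : ℝ} (he : 0 < e) (hA : 0 < A)
    (h : (x - g) ^ 2 ≤ 14 * (e ^ 2 / 20000) * A ^ 2) (hg : e * A / 32 ≤ g) : 0 < x := by
  by_contra! hx
  have h0 : 0 < e * A := by positivity
  have h1 : (e * A / 32) ^ 2 ≤ (g - x) ^ 2 := by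
    gcongr
    linarith
  nlinarith [pow_pos h0 2]

lemma eventually_le_natCast (A : ℝ) : ∀ᶠ n : ℕ in atTop, A ≤ n :=
  tendsto_natCast_atTop_atTop.eventually_ge_atTop A

/-- Sign pattern of the reproducing kernel at a point close to the origin. -/
lemma IsRegularRight.exists_kernel_sign (hv : IsRegularRight v k B W) {e : ℝ} (he : 0 < e)
    (he1 : e < 1) :
    ∃ M > 0, ∃ δ > 0, δ ≤ 1 / 4 ∧ ∀ᶠ n : ℕ in atTop, ∀ φ ∈ Icc 0 Real.pi,
      M / n ≤ Real.cos φ → Real.cos φ ≤ δ → ∀ κ : ℝ[X], κ.degree < n →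
      (∀ p : ℝ[X], p.degree < n → weightIntegral v (κ * p) = p.eval (Real.cos φ)) →
      0 < κ.eval (Real.cos φ) →
      (∀ θ, φ - (Real.pi - e) / n ≤ θ → θ ≤ φ → 0 < κ.eval (Real.cos θ)) ∧
      κ.eval (Real.cos (φ - (Real.pi + e) / n)) < 0 := by
  have hπ := Real.pi_gt_three
  have hπ' := Real.pi_lt_d2
  have hW := hv.limit_pos
  obtain ⟨ε, hε⟩ : ∃ ε, ε = e ^ 2 / 20000 := ⟨_, rfl⟩
  have hε0 : 0 < ε := by rw [hε]; positivity
  have hεe : ε ≤ e / 20000 := by rw [hε]; nlinarith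
  have hε8 : ε ≤ 1 / 8 := by linarith
  obtain ⟨M, hM, δ, hδ, hδ4, hpeak⟩ := hv.exists_peak hε0 hε8
  refine ⟨M, hM, δ / 2, by positivity, by linarith, ?_⟩
  filter_upwards [hpeak, eventually_le_natCast (3 / ε), eventually_le_natCast (10 / δ),
    eventually_le_natCast (80 / e), eventually_le_natCast 10] with n hn hn1 hn2 hn3 hn4 φ hφ hφM hφδ
    κ hκ hrep hκpos
  rw [div_le_iff₀ hε0] at hn1
  rw [div_le_iff₀ hδ] at hn2
  rw [div_le_iff₀ he] at hn3
  have hn0 : (0 : ℝ) < n := by linarith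
  have hx0 : 0 < Real.cos φ := lt_of_lt_of_le (by positivity) hφM
  have hxabs : |Real.cos φ| ≤ 1 / 2 := by rw [abs_of_pos hx0]; linarith
  have h5n : 5 / (n : ℝ) ≤ 1 / 2 := by rw [div_le_iff₀ hn0]; linarith
  have h5δ : 5 / (n : ℝ) ≤ δ / 2 := by rw [div_le_iff₀ hn0]; linarith
  have hφ1 : 1 ≤ φ := by
    by_contra! h
    have := Real.cos_lt_cos_of_nonneg_of_le_pi hφ.1 (by linarith) h
    have h2 := Real.cos_one_pos
    have h3 := Real.one_sub_sq_div_two_le_cos (x := 1)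
    linarith
  obtain ⟨q, hq1, hq2, hq3, hq4, hq5⟩ := hn φ hφ hφM (by linarith)
  have hup : ∀ θ, φ - 5 / n ≤ θ → θ ≤ φ → ∀ p : ℝ[X], p.natDegree ≤ n →
      p.eval (Real.cos θ) ^ 2 ≤ (1 + 4 * ε) * (n / (Real.pi * W)) * weightIntegral v (p ^ 2) := by
    intro θ h1 h2 p hp
    have hθ : θ ∈ Icc 0 Real.pi := ⟨by linarith, by linarith [hφ.2]⟩
    have hle : Real.cos φ ≤ Real.cos θ := Real.cos_le_cos_of_nonneg_of_le_pi hθ.1 hφ.2 h2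
    have hle2 : Real.cos θ ≤ Real.cos φ + 5 / n := by
      have h3 := Real.abs_cos_sub_cos_le θ φ
      have h4 : |θ - φ| ≤ 5 / n := abs_le.2 ⟨by linarith, by linarith⟩
      linarith [le_abs_self (Real.cos θ - Real.cos φ)]
    obtain ⟨r, hr1, hr2, hr3, hr4, -⟩ := hn θ hθ (hφM.trans hle) (by linarith)
    exact eval_sq_le_of_peak hv.intervalIntegrable hW hε0 hε8 (by linarith) hθ
      (by rw [abs_of_pos (by linarith)]; linarith) hr1 hr2 hr4 hv.pos hp
  obtain ⟨m, hm⟩ : ∃ m, m = n - 1 - q.natDegree := ⟨_, rfl⟩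
  have hqn : q.natDegree + 1 ≤ n := by
    have : (q.natDegree : ℝ) + 1 ≤ n := by nlinarith only [hq1, hε8, hn4]
    exact_mod_cast this
  have hmR : (m : ℝ) + q.natDegree + 1 = n := by
    exact_mod_cast (by omega : m + q.natDegree + 1 = n)
  have hm2 : (m : ℝ) + 1 / 2 ≤ n := by
    have : (0 : ℝ) ≤ q.natDegree := by positivity
    linarith
  have hm1 : n * (1 - 2 * ε) ≤ (m : ℝ) + 1 / 2 := by linarith
  obtain ⟨A, hA⟩ : ∃ A, A = n / (Real.pi * W) := ⟨_, rfl⟩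
  have hA0 : 0 < A := by rw [hA]; positivity
  have happrox : ∀ θ, φ - 5 / n ≤ θ → θ ≤ φ → (κ.eval (Real.cos θ) -
      1 / W * ((chebyshevKernel m (Real.cos φ)).eval (Real.cos θ) * q.eval (Real.cos θ))) ^ 2 ≤
      14 * (e ^ 2 / 20000) * A ^ 2 := by
    intro θ h1 h2
    rw [← hε, hA, hm]
    exact kernel_sub_sq_le_of_peak hv.intervalIntegrable hW hε0 hε8 (by linarith) hφ hxabs hq1 hq2
      hq3 (hup φ (by linarith [(by positivity : 0 < 5 / (n : ℝ))]) le_rfl) hκ hrep hκpos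
      (hup θ h1 h2)
  have hscale : ∀ S r : ℝ, e * n / 8 ≤ 2 * Real.pi * S → 1 / 2 ≤ r →
      e * A / 32 ≤ 1 / W * (S * r) := by
    intro S r hS hr
    have hS0 : 0 < S := by
      refine pos_of_mul_pos_right (a := 2 * Real.pi) ?_ (by positivity)
      exact lt_of_lt_of_le (by positivity) hS
    calc e * A / 32 = 1 / W * ((e * n / 8) / (2 * Real.pi) * (1 / 2)) := by rw [hA]; field_simp; norm_num
      _ ≤ 1 / W * (S * r) := by
        gcongr
        rw [div_le_iff₀ (by positivity)]; linarith
  have hdir : ∀ θ, φ - 5 / n ≤ θ → θ ≤ φ → |2 * Real.pi *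
      (chebyshevKernel m (Real.cos φ)).eval (Real.cos θ) - dirichletSum m (φ - θ)| ≤ 2 :=
    fun θ h1 h2 => abs_chebyshevKernel_sub_le m hxabs hφ ⟨by linarith, by linarith [hφ.2]⟩
  have hnear : ∀ θ, φ - 5 / n ≤ θ → θ ≤ φ → 1 / 2 ≤ q.eval (Real.cos θ) :=
    fun θ h1 h2 => hq5 θ ⟨by linarith, by linarith [hφ.2]⟩ (abs_le.2
      ⟨by linarith [(by positivity : 0 < 5 / (n : ℝ))], by linarith⟩)
  constructor
  · intro θ h1 h2
    have h1' : φ - 5 / n ≤ θ := by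
      have : (Real.pi - e) / n ≤ 5 / n := by gcongr; linarith
      linarith
    refine pos_of_sub_sq_le he hA0 (happrox θ h1' h2) (hscale _ _ ?_ (hnear θ h1' h2))
    have h3 : (m + 1 / 2) * (φ - θ) ≤ Real.pi - e := by
      have h4 : n * (φ - θ) ≤ Real.pi - e := by
        rw [← le_div_iff₀' hn0]; linarith
      exact (mul_le_mul_of_nonneg_right hm2 (by linarith)).trans h4
    have h5 := le_dirichletSum he he1 (by linarith) h3
    have h6 := (abs_le.1 (hdir θ h1' h2)).1
    have h7 : e * n * (1 / 5) ≤ 4 * e / Real.pi ^ 2 * (m + 1 / 2) := by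
      have h8 : Real.pi ^ 2 ≤ 10 := by nlinarith only [hπ, hπ']
      have h9 : (n : ℝ) / 2 ≤ m + 1 / 2 := by nlinarith only [hm1, hεe, he1, hn0]
      rw [div_mul_eq_mul_div, le_div_iff₀ (by positivity)]
      have h10 : 0 ≤ e * n := by positivity
      nlinarith only [mul_le_mul_of_nonneg_left h8 h10, mul_le_mul_of_nonneg_left h9 he.le]
    linarith
  · obtain ⟨θ, hθ⟩ : ∃ θ, θ = φ - (Real.pi + e) / n := ⟨_, rfl⟩
    rw [← hθ]
    have h1' : φ - 5 / n ≤ θ := by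
      have : (Real.pi + e) / n ≤ 5 / n := by gcongr; linarith
      linarith
    have hu0 : 0 < (Real.pi + e) / n := by positivity
    have h2 : θ ≤ φ := by linarith
    have hφθ : φ - θ = (Real.pi + e) / n := by rw [hθ]; ring
    have key : 0 < -κ.eval (Real.cos θ) := by
      refine pos_of_sub_sq_le (g := 1 / W * (-(chebyshevKernel m (Real.cos φ)).eval (Real.cos θ)
        * q.eval (Real.cos θ))) he hA0 ?_ (hscale _ _ ?_ (hnear θ h1' h2))
      · refine le_trans (le_of_eq ?_) (happrox θ h1' h2)
        ring
      · have h6 := (abs_le.1 (hdir θ h1' h2)).2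
        have hle1 : (m + 1 / 2) * (φ - θ) ≤ Real.pi + e := by
          have h4 : n * (φ - θ) ≤ Real.pi + e := by
            rw [← le_div_iff₀' hn0]; linarith
          exact (mul_le_mul_of_nonneg_right hm2 (by linarith)).trans h4
        have hle2 : Real.pi + e / 2 ≤ (m + 1 / 2) * (φ - θ) := by
          have h4 : n * (1 - 2 * ε) * ((Real.pi + e) / n) ≤ (m + 1 / 2) * (φ - θ) := by
            rw [hφθ]
            exact mul_le_mul_of_nonneg_right hm1 hu0.le
          refine le_trans ?_ h4
          have h5 : n * (1 - 2 * ε) * ((Real.pi + e) / n) = (1 - 2 * ε) * (Real.pi + e) := by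
            field_simp
          rw [h5]
          nlinarith only [hεe, hε0, he, he1, hπ, hπ']
        have h5 := dirichletSum_le_neg he he1 (u := φ - θ) (by
          rw [hφθ, div_le_iff₀ hn0]; linarith) (by linarith) hle2 hle1
        have h7 : e * n * (3 / 20) ≤ 2 * e / (Real.pi * (φ - θ)) := by
          rw [hφθ, le_div_iff₀ (by positivity)]
          have h8 : Real.pi * (Real.pi + e) ≤ 40 / 3 := by nlinarith only [hπ, hπ', he, he1]
          calc e * n * (3 / 20) * (Real.pi * ((Real.pi + e) / n))
              = e * (3 / 20) * (Real.pi * (Real.pi + e)) := by field_simp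
            _ ≤ e * (3 / 20) * (40 / 3) := by gcongr
            _ = 2 * e := by ring
        linarith
    linarith

/-- Clock spacing of the zeros to the right of the origin, at distance at least `M / n`. -/
lemma IsRegularRight.exists_zero_spacing (hv : IsRegularRight v k B W) {e : ℝ} (he : 0 < e)
    (he1 : e < 1) :
    ∃ M > 0, ∃ δ > 0, δ ≤ 1 / 4 ∧ ∀ᶠ n : ℕ in atTop, ∀ P : ℝ[X], P ≠ 0 → P.natDegree = n →
      (∀ k < n, weightIntegral v (P * X ^ k) = 0) → ∀ φ ∈ Icc 0 Real.pi,
      M / n ≤ Real.cos φ → Real.cos φ ≤ δ → P.eval (Real.cos φ) = 0 →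
      (∀ θ, 0 ≤ θ → φ - (Real.pi - e) / n ≤ θ → θ < φ → P.eval (Real.cos θ) ≠ 0) ∧
      ∃ θ, 0 ≤ θ ∧ φ - (Real.pi + e) / n < θ ∧ θ < φ ∧ P.eval (Real.cos θ) = 0 := by
  have hπ := Real.pi_gt_three
  have hπ' := Real.pi_lt_d2
  obtain ⟨M, hM, δ, hδ, hδ4, hsign⟩ := hv.exists_kernel_sign he he1
  refine ⟨M, hM, δ, hδ, hδ4, ?_⟩
  filter_upwards [hsign, eventually_le_natCast 10] with n hn hn1 P hP hdeg horth φ hφ hφM hφδ hzero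
  have hn0 : (0 : ℝ) < n := by linarith
  obtain ⟨κ, hκ1, hκ2, hκ3, a, ha, hPκ⟩ :=
    exists_reproducing_of_root hv.intervalIntegrable hv.pos hP hdeg horth hzero
  obtain ⟨hpos, hneg⟩ := hn φ hφ hφM hφδ κ hκ1 hκ2 hκ3
  have hu0 : 0 < (Real.pi + e) / n := by positivity
  refine ⟨fun θ h0 h1 h2 => ?_, ?_⟩
  · rw [hPκ]
    simp only [eval_mul, eval_C, eval_sub, eval_X]
    have := Real.cos_lt_cos_of_nonneg_of_le_pi h0 hφ.2 h2
    exact mul_ne_zero ha (mul_ne_zero (by linarith) (hpos θ h1 h2.le).ne')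
  · have hcont : ContinuousOn (fun θ => κ.eval (Real.cos θ)) (Icc (φ - (Real.pi + e) / n) φ) := by
      fun_prop
    obtain ⟨θ, hθ, hθ0⟩ := intermediate_value_Ioo (by linarith) hcont ⟨hneg, hκ3⟩
    refine ⟨θ, ?_, hθ.1, hθ.2, ?_⟩
    · have hφ1 : 1 ≤ φ := by
        by_contra! h
        have := Real.cos_lt_cos_of_nonneg_of_le_pi hφ.1 (by linarith) h
        have h3 := Real.one_sub_sq_div_two_le_cos (x := 1)
        linarith
      have : (Real.pi + e) / n ≤ 1 := by rw [div_le_iff₀ hn0]; linarith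
      linarith [hθ.1]
    · rw [hPκ]
      simp only at hθ0
      simp [hθ0]

end LocalSpacing

section Separation

variable {v : ℝ → ℝ} {k : ℕ} {B W : ℝ}

lemma natDegree_one_sub_sq_pow_le (k : ℕ) : ((1 - X ^ 2 : ℝ[X]) ^ k).natDegree ≤ k * 2 :=
  natDegree_pow_le.trans (Nat.mul_le_mul_left _ (by compute_degree))

/-- Consecutive zeros on the right of the origin are at distance at least a constant times
`1 / n`. -/
lemma IsRegularRight.exists_separation (hv : IsRegularRight v k B W) :
    ∃ c₀ > 0, ∀ᶠ n : ℕ in atTop, ∀ P : ℝ[X], P ≠ 0 → P.natDegree = n →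
      (∀ k < n, weightIntegral v (P * X ^ k) = 0) → ∀ ξ ξ' : ℝ, 0 < ξ → ξ < ξ' → ξ' ≤ 1 / 2 →
      P.eval ξ = 0 → P.eval ξ' = 0 → c₀ / n ≤ ξ' - ξ := by
  have hB := hv.const_pos
  have hπ := Real.pi_pos
  have hπ4 := Real.pi_le_four
  obtain ⟨s, hs⟩ : ∃ s : ℝ, s = ((3 / 4) ^ k) ^ 2 := ⟨_, rfl⟩
  have hs0 : 0 < s := by rw [hs]; positivity
  refine ⟨3 * s / (32 * B), by positivity, ?_⟩
  filter_upwards [eventually_ge_atTop (4 * k + 3)] with n hn P hP hdeg horth ξ ξ' hξ hξξ' hξ' h0 h0'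
  have hn0 : (0 : ℝ) < n := by exact_mod_cast (by omega : 0 < n)
  obtain ⟨κ, hκ1, hκ2, hκ3, a, ha, hPκ⟩ :=
    exists_reproducing_of_root hv.intervalIntegrable hv.pos hP hdeg horth h0
  have hκξ' : κ.eval ξ' = 0 := by
    rw [hPκ] at h0'
    simp only [eval_mul, eval_C, eval_sub, eval_X, mul_eq_zero] at h0'
    rcases h0' with h | h | h
    · exact absurd h ha
    · linarith
    · exact h
  have hκn : κ.natDegree ≤ n - 1 := by
    rcases eq_or_ne κ 0 with rfl | hκ0
    · simp
    · have := (natDegree_lt_iff_degree_lt hκ0).2 hκ1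
      omega
  have hκκ : weightIntegral v (κ ^ 2) = κ.eval ξ := by rw [sq]; exact hκ2 κ hκ1
  obtain ⟨φ, hφ⟩ : ∃ φ, φ = Real.arccos ξ := ⟨_, rfl⟩
  obtain ⟨φ', hφ'⟩ : ∃ φ', φ' = Real.arccos ξ' := ⟨_, rfl⟩
  have hcos : Real.cos φ = ξ := by rw [hφ]; exact Real.cos_arccos (by linarith) (by linarith)
  have hcos' : Real.cos φ' = ξ' := by rw [hφ']; exact Real.cos_arccos (by linarith) (by linarith)
  have hφI : φ ∈ Icc 0 Real.pi := by
    rw [hφ]; exact ⟨Real.arccos_nonneg _, Real.arccos_le_pi _⟩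
  have hφ0' : 0 ≤ φ' := by rw [hφ']; exact Real.arccos_nonneg _
  have hφφ' : φ' ≤ φ := by rw [hφ, hφ']; exact Real.antitone_arccos hξξ'.le
  have hsξ : s ≤ ((1 - ξ ^ 2) ^ k) ^ 2 := by
    rw [hs]; gcongr; nlinarith
  -- upper bound of the kernel by the separation
  have hupper : s * κ.eval ξ ≤ 8 * B * n ^ 3 * (φ' - φ) ^ 2 := by
    have hdegp : (κ * (1 - X ^ 2) ^ k).natDegree ≤ 2 * n :=
      natDegree_mul_le.trans ((add_le_add hκn (natDegree_one_sub_sq_pow_le k)).trans (by omega))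
    have h1 := sub_eval_sq_le φ' φ hdegp
    rw [hcos, hcos'] at h1
    simp only [eval_mul, eval_pow, eval_sub, eval_one, eval_X, hκξ', zero_mul, zero_sub,
      neg_sq] at h1
    have h2 : weightIntegral chebyshevWeight ((κ * (1 - X ^ 2) ^ k) ^ 2) ≤ B * κ.eval ξ := by
      rw [← hκκ, ← weightIntegral_C_mul]
      refine weightIntegral_mono intervalIntegrable_chebyshevWeight hv.intervalIntegrable
        fun y hy => ?_
      simp only [eval_mul, eval_pow, eval_sub, eval_one, eval_X, eval_C]
      have := mul_le_mul_of_nonneg_left (hv.lower y hy) (sq_nonneg (κ.eval y))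
      linarith
    have h3 : s * κ.eval ξ * κ.eval ξ ≤ 8 * B * n ^ 3 * (φ' - φ) ^ 2 * κ.eval ξ := by
      calc s * κ.eval ξ * κ.eval ξ ≤ ((1 - ξ ^ 2) ^ k) ^ 2 * (κ.eval ξ * κ.eval ξ) := by
            rw [mul_assoc]
            exact mul_le_mul_of_nonneg_right hsξ (by positivity)
        _ = (κ.eval ξ * (1 - ξ ^ 2) ^ k) ^ 2 := by ring
        _ ≤ _ := h1
        _ ≤ ((2 * n : ℕ) : ℝ) ^ 3 * (φ' - φ) ^ 2 * (B * κ.eval ξ) := by gcongr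
        _ = _ := by push_cast; ring
    exact le_of_mul_le_mul_right h3 hκ3
  have hlower : s * (n / (2 * Real.pi)) ≤ B * κ.eval ξ := by
    obtain ⟨m, hm⟩ : ∃ m, m = n - 1 - 2 * k := ⟨_, rfl⟩
    obtain ⟨K, hK⟩ : ∃ K, K = chebyshevKernel m ξ := ⟨_, rfl⟩
    have hKdeg : K.natDegree ≤ m := by rw [hK]; exact natDegree_chebyshevKernel_le _ _
    have hself : 2 * m - 1 ≤ 2 * Real.pi * K.eval ξ := by
      rw [hK, ← hcos]
      exact le_chebyshevKernel_self m (by rw [hcos, abs_of_pos hξ]; linarith) hφI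
    have hmn : (n : ℝ) + 1 ≤ 2 * m := by
      have : n + 1 ≤ 2 * m := by omega
      exact_mod_cast this
    have hKn : n / (2 * Real.pi) ≤ K.eval ξ := by
      rw [div_le_iff₀ (by positivity)]; linarith
    have hK0 : 0 < K.eval ξ := lt_of_lt_of_le (by positivity) hKn
    have hgdeg : (K * (1 - X ^ 2) ^ k).degree < (n : WithBot ℕ) := by
      refine degree_le_natDegree.trans_lt ?_
      have : (K * (1 - X ^ 2) ^ k).natDegree < n :=
        (natDegree_mul_le.trans (add_le_add hKdeg (natDegree_one_sub_sq_pow_le k))).trans_lt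
          (by omega)
      exact_mod_cast this
    have h1 := weightIntegral_mul_sq_le hv.intervalIntegrable hv.pos κ (K * (1 - X ^ 2) ^ k)
    rw [hκ2 _ hgdeg, hκκ] at h1
    simp only [eval_mul, eval_pow, eval_sub, eval_one, eval_X] at h1
    have h2 : weightIntegral v ((K * (1 - X ^ 2) ^ k) ^ 2) ≤ B * K.eval ξ := by
      have hKK : weightIntegral chebyshevWeight (K * K) = K.eval ξ := by
        have := weightIntegral_chebyshevKernel_mul ξ hKdeg
        rwa [← hK] at this
      rw [← hKK, ← weightIntegral_C_mul]
      refine weightIntegral_mono hv.intervalIntegrable intervalIntegrable_chebyshevWeight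
        fun y hy => ?_
      simp only [eval_mul, eval_pow, eval_sub, eval_one, eval_X, eval_C]
      have h3 : ((1 - y ^ 2) ^ k) ^ 2 * v y ≤ B * chebyshevWeight y :=
        (hv.upper y hy).trans (le_mul_of_one_le_right hB.le (one_le_chebyshevWeight hy))
      have := mul_le_mul_of_nonneg_left h3 (sq_nonneg (K.eval y))
      linarith
    have h4 : s * K.eval ξ * K.eval ξ ≤ B * κ.eval ξ * K.eval ξ := by
      calc s * K.eval ξ * K.eval ξ ≤ ((1 - ξ ^ 2) ^ k) ^ 2 * (K.eval ξ * K.eval ξ) := by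
            rw [mul_assoc]
            exact mul_le_mul_of_nonneg_right hsξ (by positivity)
        _ = (K.eval ξ * (1 - ξ ^ 2) ^ k) ^ 2 := by ring
        _ ≤ _ := h1
        _ ≤ κ.eval ξ * (B * K.eval ξ) := by gcongr
        _ = _ := by ring
    exact (mul_le_mul_of_nonneg_left hKn hs0.le).trans (le_of_mul_le_mul_right h4 hK0)
  have hgap : s / (8 * B * n) ≤ φ - φ' := by
    refine le_of_sq_le_sq ?_ (by linarith)
    have h1 : s * (s * (n / (2 * Real.pi))) ≤ B * (8 * B * n ^ 3 * (φ' - φ) ^ 2) := by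
      calc s * (s * (n / (2 * Real.pi))) ≤ s * (B * κ.eval ξ) := by gcongr
        _ = B * (s * κ.eval ξ) := by ring
        _ ≤ _ := by gcongr
    have h2 : s * (s * (n / 8)) ≤ s * (s * (n / (2 * Real.pi))) := by
      gcongr; linarith
    rw [div_pow, div_le_iff₀ (by positivity)]
    have h3 := h2.trans h1
    refine le_of_mul_le_mul_right ?_ (by positivity : (0 : ℝ) < n / 8)
    linarith
  have hfin := le_cos_sub_cos (d := 1 / 2) hφ0' hφφ' hφI.2 (by rw [hcos]; exact hξ.le)
    (by rw [hcos']; exact hξ')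
  rw [hcos, hcos'] at hfin
  have h5 : 3 * s / (32 * B) / n = 3 / 4 * (s / (8 * B * n)) := by field_simp; norm_num
  rw [h5]
  linarith

end Separation

section Density

variable {v : ℝ → ℝ} {a b : ℝ}

lemma exists_weightIntegral_neg (hv : IntervalIntegrable v volume (-1) 1)
    (hpos : ∀ y ∈ Ioo (-1 : ℝ) 1, 0 < v y) (ha : -1 < a) (hab : a < b) (hb : b < 1) :
    ∃ s : ℝ[X], weightIntegral v ((X - C a) * (X - C b) * s ^ 2) < 0 := by
  obtain ⟨f, hf⟩ : ∃ f : ℝ → ℝ, f = fun y => max 0 ((y - a) * (b - y)) := ⟨_, rfl⟩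
  have hfc : Continuous f := by rw [hf]; fun_prop
  have hInt : IntervalIntegrable (fun y => f y ^ 3 * v y) volume (-1) 1 :=
    hv.continuousOn_mul (hfc.pow 3).continuousOn
  have hsub : uIcc a b ⊆ uIcc (-1) 1 := by
    rw [uIcc_of_le hab.le, uIcc_of_le (by norm_num)]
    exact Icc_subset_Icc ha.le hb.le
  have hf0 : ∀ y, 0 ≤ f y := fun y => by rw [hf]; exact le_max_left _ _
  obtain ⟨I, hI⟩ : ∃ I, I = ∫ y in (-1 : ℝ)..1, f y ^ 3 * v y := ⟨_, rfl⟩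
  have hI0 : 0 < I := by
    have h1 : 0 < ∫ y in a..b, f y ^ 3 * v y := by
      refine intervalIntegral.intervalIntegral_pos_of_pos_on (hInt.mono_set hsub) (fun y hy => ?_)
        hab
      have : 0 < f y := by
        rw [hf]
        exact lt_max_of_lt_right (mul_pos (by linarith [hy.1]) (by linarith [hy.2]))
      have := hpos y ⟨by linarith [hy.1], by linarith [hy.2]⟩
      positivity
    have h2 : (∫ y in a..b, f y ^ 3 * v y) ≤ I := by
      rw [hI]
      refine intervalIntegral.integral_mono_interval ha.le hab.le hb.le ?_ hInt
      rw [← restrict_Ioo_eq_restrict_Ioc]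
      filter_upwards [ae_restrict_mem measurableSet_Ioo] with y hy
      have := hpos y hy
      have := hf0 y
      simp only [Pi.zero_apply]
      positivity
    linarith
  obtain ⟨V, hV⟩ : ∃ V, V = weightIntegral v 1 := ⟨_, rfl⟩
  have hV0 : 0 < V := by
    rw [hV]; exact weightIntegral_pos hv hpos one_ne_zero fun y _ => by simp
  obtain ⟨τ, hτ0, hτ1, hτ⟩ : ∃ τ > 0, τ ≤ 1 ∧ 36 * τ * V < I := by
    refine ⟨min 1 (I / (72 * V)), by positivity, min_le_left _ _, ?_⟩
    have := min_le_right 1 (I / (72 * V))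
    rw [le_div_iff₀ (by positivity)] at this
    linarith
  obtain ⟨s, hs⟩ := exists_polynomial_near_of_continuousOn (-1) 1 f hfc.continuousOn τ hτ0
  refine ⟨s, ?_⟩
  have hle : weightIntegral v ((X - C a) * (X - C b) * s ^ 2) ≤ -I + 36 * τ * V := by
    have hi1 : IntervalIntegrable (fun y => -(f y ^ 3 * v y)) volume (-1) 1 := hInt.neg
    have hi2 : IntervalIntegrable (fun y => 36 * τ * v y) volume (-1) 1 := hv.const_mul _
    have h1 : -I + 36 * τ * V = ∫ y in (-1 : ℝ)..1, (-(f y ^ 3 * v y) + 36 * τ * v y) := by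
      rw [intervalIntegral.integral_add hi1 hi2, intervalIntegral.integral_neg,
        intervalIntegral.integral_const_mul, hI, hV]
      simp [weightIntegral]
    rw [h1]
    unfold weightIntegral
    refine intervalIntegral.integral_mono_on_of_le_Ioo (by norm_num)
      (intervalIntegrable_eval_mul hv _) (hi1.add hi2)
      fun y hy => ?_
    have hvy := hpos y hy
    have hy' : y ∈ Icc (-1 : ℝ) 1 := ⟨hy.1.le, hy.2.le⟩
    simp only [eval_mul, eval_sub, eval_X, eval_C, eval_pow]
    suffices h : (y - a) * (y - b) * s.eval y ^ 2 ≤ -f y ^ 3 + 36 * τ by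
      have := mul_le_mul_of_nonneg_right h hvy.le
      linarith
    have hu1 : |(y - a) * (y - b)| ≤ 4 := by
      rw [abs_mul]
      have h2 : |y - a| ≤ 2 := abs_le.2 ⟨by linarith [hy.1], by linarith [hy.2]⟩
      have h3 : |y - b| ≤ 2 := abs_le.2 ⟨by linarith [hy.1], by linarith [hy.2]⟩
      nlinarith [abs_nonneg (y - a), abs_nonneg (y - b)]
    have hneg : (y - a) * (b - y) = -((y - a) * (y - b)) := by ring
    obtain ⟨u, hu⟩ : ∃ u, u = (y - a) * (y - b) := ⟨_, rfl⟩
    have hfy : f y = max 0 (-u) := by rw [hf, hu, ← hneg]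
    have hf4 : f y ≤ 4 := by
      rw [hfy]; exact max_le (by norm_num) (by rw [hu]; linarith [(abs_le.1 hu1).1])
    have huf : u * f y ^ 2 ≤ -f y ^ 3 := by
      rcases le_total 0 u with h | h
      · rw [hfy, max_eq_left (by linarith)]; simp
      · rw [hfy, max_eq_right (by linarith)]; apply le_of_eq; ring
    have hsf := abs_lt.1 (hs y hy')
    rw [← hu] at hu1 ⊢
    have hd : |s.eval y ^ 2 - f y ^ 2| ≤ 9 * τ := by
      rw [sq_sub_sq, abs_mul]
      have h2 : |s.eval y + f y| ≤ 9 := abs_le.2 ⟨by linarith [hf0 y], by linarith⟩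
      exact mul_le_mul h2 (hs y hy').le (abs_nonneg _) (by norm_num)
    have h5 : u * (s.eval y ^ 2 - f y ^ 2) ≤ 36 * τ := by
      refine (le_abs_self _).trans ?_
      rw [abs_mul]
      calc _ ≤ 4 * (9 * τ) := by gcongr
        _ = _ := by ring
    linarith
  linarith

/-- The zeros of orthogonal polynomials are dense in `[-1, 1]`. -/
lemma eventually_exists_root (hv : IntervalIntegrable v volume (-1) 1)
    (hpos : ∀ y ∈ Ioo (-1 : ℝ) 1, 0 < v y) (ha : -1 < a) (hab : a < b) (hb : b < 1) :
    ∀ᶠ n : ℕ in atTop, ∀ P : ℝ[X], P ≠ 0 → P.natDegree = n →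
      (∀ k < n, weightIntegral v (P * X ^ k) = 0) → ∃ t ∈ Ioo a b, P.eval t = 0 := by
  obtain ⟨s, hs⟩ := exists_weightIntegral_neg hv hpos ha hab hb
  filter_upwards [eventually_gt_atTop ((X - C a) * (X - C b) * s ^ 2).natDegree] with n hn P hP hdeg
    horth
  by_contra! h
  refine hs.not_ge (weightIntegral_nonneg_of_nonneg_on_roots hv hpos hP hdeg horth (by omega)
    fun x hx => ?_)
  simp only [eval_mul, eval_sub, eval_X, eval_C, eval_pow]
  refine mul_nonneg ?_ (sq_nonneg _)
  rcases le_or_gt x a with hxa | hxa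
  · nlinarith
  · rcases le_or_gt b x with hxb | hxb
    · nlinarith
    · exact absurd hx (h x ⟨hxa, hxb⟩)

end Density

section OneSided

lemma tendsto_liminf_limsup_of_eventually_abs_sub_le {f : ℕ → ℕ → ℝ} {l : ℝ}
    (h : ∀ e : ℝ, 0 < e → e < 1 → ∃ J, ∀ j ≥ J, ∀ᶠ n in atTop, |f j n - l| ≤ e) :
    Tendsto (fun j => liminf (f j) atTop) atTop (nhds l) ∧
      Tendsto (fun j => limsup (f j) atTop) atTop (nhds l) := by
  have key : ∀ e : ℝ, 0 < e → ∃ J, ∀ j ≥ J,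
      |liminf (f j) atTop - l| < e ∧ |limsup (f j) atTop - l| < e := by
    intro e he
    obtain ⟨J, hJ⟩ := h (min (e / 2) (1 / 2)) (by positivity)
      ((min_le_right _ _).trans_lt (by norm_num))
    refine ⟨J, fun j hj => ?_⟩
    have hle : ∀ᶠ n in atTop, f j n ≤ l + e / 2 := by
      filter_upwards [hJ j hj] with n hn
      linarith [(abs_le.1 hn).2, min_le_left (e / 2) (1 / 2)]
    have hge : ∀ᶠ n in atTop, l - e / 2 ≤ f j n := by
      filter_upwards [hJ j hj] with n hn
      linarith [(abs_le.1 hn).1, min_le_left (e / 2) (1 / 2)]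
    have hb1 : IsBoundedUnder (· ≤ ·) atTop (f j) := ⟨_, hle⟩
    have hb2 : IsBoundedUnder (· ≥ ·) atTop (f j) := ⟨_, hge⟩
    have h1 : l - e / 2 ≤ liminf (f j) atTop := le_liminf_of_le hb1.isCoboundedUnder_ge hge
    have h2 : limsup (f j) atTop ≤ l + e / 2 := limsup_le_of_le hb2.isCoboundedUnder_le hle
    have h3 : liminf (f j) atTop ≤ limsup (f j) atTop := liminf_le_limsup hb1 hb2
    constructor <;> rw [abs_lt] <;> constructor <;> linarith
  constructor <;> rw [Metric.tendsto_atTop] <;> intro e he <;> obtain ⟨J, hJ⟩ := key e he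
  · exact ⟨J, fun j hj => by rw [Real.dist_eq]; exact (hJ j hj).1⟩
  · exact ⟨J, fun j hj => by rw [Real.dist_eq]; exact (hJ j hj).2⟩

variable {v : ℝ → ℝ} {k : ℕ} {B W : ℝ}

/-- Clock behavior, in the limit, of the zeros of orthogonal polynomials to the right of the
origin. -/
lemma IsRegularRight.clock (hv : IsRegularRight v k B W) {P : ℕ → ℝ[X]} (hP : ∀ n, P n ≠ 0)
    (hdeg : ∀ n, (P n).natDegree = n)
    (horth : ∀ n, ∀ k < n, weightIntegral v (P n * X ^ k) = 0) {N : ℕ → ℕ} {y : ℕ → ℕ → ℝ}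
    (hzero : ∀ j n, N j ≤ n → (P n).eval (y n j) = 0)
    (hmono : ∀ j n, N j ≤ n → N (j + 1) ≤ n → y n j < y n (j + 1))
    (hsign : ∀ n, N 0 ≤ n → 0 ≤ y n 0)
    (hmin : ∀ᶠ n in atTop, ∀ t, (P n).eval t = 0 → 0 < t → y n 0 ≤ t)
    (hconsec : ∀ j n, N j ≤ n → N (j + 1) ≤ n → ∀ t, (P n).eval t = 0 →
      ¬(y n j < t ∧ t < y n (j + 1))) {e : ℝ} (he : 0 < e) (he1 : e < 1) :
    ∃ J, ∀ j ≥ J, ∀ᶠ n : ℕ in atTop, |(n : ℝ) / Real.pi * (y n (j + 1) - y n j) - 1| ≤ e := by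
  have hπ := Real.pi_gt_three
  have hπ' := Real.pi_lt_d2
  have hsmall : ∀ j, ∀ d : ℝ, 0 < d → d < 1 → ∀ᶠ n in atTop, y n j < d := by
    intro j
    induction j with
    | zero =>
      intro d hd hd1
      filter_upwards [eventually_exists_root hv.intervalIntegrable hv.pos (a := d / 2) (b := d)
        (by linarith) (by linarith) hd1, hmin] with n hn hm
      obtain ⟨t, ht, ht0⟩ := hn (P n) (hP n) (hdeg n) (horth n)
      exact (hm t ht0 (by linarith [ht.1])).trans_lt ht.2
    | succ j ih =>
      intro d hd hd1
      filter_upwards [eventually_exists_root hv.intervalIntegrable hv.pos (a := d / 2) (b := d)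
        (by linarith) (by linarith) hd1, ih (d / 2) (by linarith) (by linarith),
        eventually_ge_atTop (N j), eventually_ge_atTop (N (j + 1))] with n hn hj h1 h2
      obtain ⟨t, ht, ht0⟩ := hn (P n) (hP n) (hdeg n) (horth n)
      by_contra! hcon
      exact hconsec j n h1 h2 t ht0 ⟨hj.trans ht.1, ht.2.trans_le hcon⟩
  obtain ⟨c₀, hc₀, hsep⟩ := hv.exists_separation
  have hlarge : ∀ j : ℕ, ∀ᶠ n : ℕ in atTop, 0 < y n (j + 1) ∧ c₀ * j / n ≤ y n (j + 1) := by
    intro j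
    induction j with
    | zero =>
      filter_upwards [eventually_ge_atTop (N 0), eventually_ge_atTop (N 1)] with n h0 h1
      have := (hsign n h0).trans_lt (hmono 0 n h0 h1)
      simpa using ⟨this, this.le⟩
    | succ j ih =>
      filter_upwards [eventually_ge_atTop (N (j + 1)), eventually_ge_atTop (N (j + 1 + 1)), ih,
        hsep, hsmall (j + 1 + 1) (1 / 2) (by norm_num) (by norm_num)] with n h0 h1 h2 h3 h4
      have h5 := hmono (j + 1) n h0 h1
      have h6 := h3 (P n) (hP n) (hdeg n) (horth n) _ _ h2.1 h5 h4.le (hzero _ _ h0) (hzero _ _ h1)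
      refine ⟨h2.1.trans h5, ?_⟩
      have h7 : c₀ * ((j + 1 : ℕ) : ℝ) / n = c₀ * j / n + c₀ / n := by push_cast; ring
      rw [h7]
      linarith [h2.2]
  obtain ⟨M, hM, δ, hδ, hδ4, hspace⟩ := hv.exists_zero_spacing he he1
  refine ⟨⌈M / c₀⌉₊ + 1, fun j hj => ?_⟩
  obtain ⟨i, rfl⟩ : ∃ i, j = i + 1 := ⟨j - 1, by omega⟩
  have hi : M ≤ c₀ * i := by
    have h1 : ((⌈M / c₀⌉₊ : ℕ) : ℝ) ≤ i := by exact_mod_cast (by omega : ⌈M / c₀⌉₊ ≤ i)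
    have h2 := (Nat.le_ceil (M / c₀)).trans h1
    rw [div_le_iff₀ hc₀] at h2
    linarith
  filter_upwards [hspace, hlarge i, hsmall (i + 1) δ hδ (by linarith),
    hsmall (i + 1 + 1) (e / 4) (by linarith) (by linarith),
    eventually_ge_atTop (N (i + 1)), eventually_ge_atTop (N (i + 1 + 1)),
    eventually_gt_atTop 0] with n hn hlo hup hup' h1 h2 hnpos
  have hn0 : (0 : ℝ) < n := by exact_mod_cast hnpos
  have hlt := hmono (i + 1) n h1 h2
  obtain ⟨ξ, hξ⟩ : ∃ ξ, ξ = y n (i + 1) := ⟨_, rfl⟩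
  obtain ⟨ξ', hξ'⟩ : ∃ ξ', ξ' = y n (i + 1 + 1) := ⟨_, rfl⟩
  have hz := hzero (i + 1) n h1
  have hz' := hzero (i + 1 + 1) n h2
  have hc := hconsec (i + 1) n h1 h2
  rw [← hξ] at hlo hup hlt hz hc
  rw [← hξ'] at hup' hlt hz' hc
  rw [← hξ, ← hξ']
  obtain ⟨φ, hφ⟩ : ∃ φ, φ = Real.arccos ξ := ⟨_, rfl⟩
  obtain ⟨φ', hφ'⟩ : ∃ φ', φ' = Real.arccos ξ' := ⟨_, rfl⟩
  have hcos : Real.cos φ = ξ := by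
    rw [hφ]; exact Real.cos_arccos (by linarith [hlo.1]) (by linarith)
  have hcos' : Real.cos φ' = ξ' := by
    rw [hφ']; exact Real.cos_arccos (by linarith [hlo.1]) (by linarith)
  have hφI : φ ∈ Icc 0 Real.pi := by
    rw [hφ]; exact ⟨Real.arccos_nonneg _, Real.arccos_le_pi _⟩
  have hφ0' : 0 ≤ φ' := by rw [hφ']; exact Real.arccos_nonneg _
  have hφφ' : φ' < φ := by
    rw [hφ, hφ']
    exact Real.strictAntiOn_arccos ⟨by linarith [hlo.1], by linarith⟩
      ⟨by linarith [hlo.1], by linarith⟩ hlt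
  have hMξ : M / n ≤ ξ := le_trans (by gcongr) hlo.2
  obtain ⟨hno, θ, hθ0, hθ1, hθ2, hθz⟩ := hn (P n) (hP n) (hdeg n) (horth n) φ hφI
    (by rw [hcos]; exact hMξ) (by rw [hcos]; exact hup.le) (by rw [hcos]; exact hz)
  have hupper : n * (ξ' - ξ) ≤ Real.pi + e := by
    have h3 : Real.cos φ < Real.cos θ := Real.cos_lt_cos_of_nonneg_of_le_pi hθ0 hφI.2 hθ2
    rw [hcos] at h3
    have h4 : ξ' ≤ Real.cos θ := by
      by_contra! hcon
      exact hc _ hθz ⟨h3, hcon⟩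
    have h5 := (le_abs_self _).trans (Real.abs_cos_sub_cos_le θ φ)
    rw [abs_of_neg (by linarith), hcos] at h5
    rw [← le_div_iff₀' hn0]
    linarith
  have hlower : Real.pi - 2 * e ≤ n * (ξ' - ξ) := by
    have h3 : (Real.pi - e) / n ≤ φ - φ' := by
      by_contra! hcon
      exact hno φ' hφ0' (by linarith) hφφ' (by rw [hcos']; exact hz')
    have h4 := le_cos_sub_cos (d := e / 4) hφ0' hφφ'.le hφI.2 (by rw [hcos]; exact hlo.1.le)
      (by rw [hcos']; exact hup'.le)
    rw [hcos, hcos'] at h4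
    rw [div_le_iff₀ hn0] at h3
    have h5 : 0 ≤ 1 - (e / 4) ^ 2 := by nlinarith only [he, he1]
    have h6 := mul_le_mul_of_nonneg_left h3 h5
    have h7 := mul_le_mul_of_nonneg_right h4 hn0.le
    have h8 : Real.pi - 2 * e ≤ (1 - (e / 4) ^ 2) * (Real.pi - e) := by
      nlinarith only [he, he1, hπ, hπ', mul_pos he he]
    linarith
  have h3 : n / Real.pi * (ξ' - ξ) - 1 = (n * (ξ' - ξ) - Real.pi) / Real.pi := by field_simp
  rw [h3, abs_div, abs_of_pos Real.pi_pos, div_le_iff₀ Real.pi_pos, abs_le]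
  constructor <;> nlinarith only [hupper, hlower, hπ, he]

end OneSided

section Jacobi

lemma pow_le_mul_rpow {u α : ℝ} {k : ℕ} (hu : 0 < u) (hu2 : u ≤ 2) (hα : |α| ≤ k) :
    u ^ k ≤ 4 ^ k * u ^ α := by
  obtain ⟨h1, h2⟩ := abs_le.1 hα
  calc u ^ k = u ^ ((k : ℝ) - α) * u ^ α := by
        rw [← Real.rpow_add hu, sub_add_cancel, Real.rpow_natCast]
    _ ≤ 4 ^ k * u ^ α := by
        gcongr
        calc u ^ ((k : ℝ) - α) ≤ 2 ^ ((k : ℝ) - α) := by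
              apply Real.rpow_le_rpow hu.le hu2; linarith
          _ ≤ 2 ^ (((2 * k : ℕ) : ℝ)) := by
              apply Real.rpow_le_rpow_of_exponent_le (by norm_num); push_cast; linarith
          _ = 4 ^ k := by rw [Real.rpow_natCast, pow_mul]; norm_num

lemma pow_mul_rpow_le {u α : ℝ} {k : ℕ} (hu : 0 < u) (hu2 : u ≤ 2) (hα : |α| ≤ k) :
    u ^ k * u ^ α ≤ 4 ^ k := by
  have h := pow_le_mul_rpow hu hu2 (α := -α) (by rwa [abs_neg])
  rwa [Real.rpow_neg hu.le, ← div_eq_mul_inv, le_div_iff₀ (by positivity)] at h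

lemma one_sub_sq_mul_chebyshevWeight_le {y : ℝ} (hy : y ∈ Ioo (-1 : ℝ) 1) :
    (1 - y ^ 2) * chebyshevWeight y ≤ 1 := by
  have h0 : 0 < 1 - y ^ 2 := by nlinarith [hy.1, hy.2]
  have h1 : 1 ≤ (1 - y ^ 2)⁻¹ := (one_le_inv₀ h0).2 (by nlinarith)
  have h2 : chebyshevWeight y ≤ (1 - y ^ 2)⁻¹ := by
    unfold chebyshevWeight
    rw [Real.sqrt_le_left (by positivity)]
    nlinarith
  calc _ ≤ (1 - y ^ 2) * (1 - y ^ 2)⁻¹ := by gcongr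
    _ = 1 := mul_inv_cancel₀ h0.ne'

lemma intervalIntegrable_jacobi {α β : ℝ} (hα : -1 < α) (hβ : -1 < β) :
    IntervalIntegrable (fun x : ℝ => (1 - x) ^ α * (1 + x) ^ β) volume (-1) 1 := by
  have hr : IntervalIntegrable (fun x : ℝ => (1 - x) ^ α) volume 0 1 := by
    have := ((intervalIntegral.intervalIntegrable_rpow' hα (a := 0) (b := 1)).comp_sub_left 1)
    simpa using this.symm
  have hl : IntervalIntegrable (fun x : ℝ => (1 + x) ^ β) volume (-1) 0 := by
    have := ((intervalIntegral.intervalIntegrable_rpow' hβ (a := 0) (b := 1)).comp_add_left 1)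
    simpa using this
  refine IntervalIntegrable.trans (b := 0) ?_ ?_
  · refine hl.continuousOn_mul (ContinuousOn.rpow_const (by fun_prop) fun x hx => Or.inl ?_)
    rw [uIcc_of_le (by norm_num)] at hx
    linarith [hx.2]
  · refine hr.mul_continuousOn (ContinuousOn.rpow_const (by fun_prop) fun x hx => Or.inl ?_)
    rw [uIcc_of_le (by norm_num)] at hx
    linarith [hx.1]

lemma exists_isRegularRight {g v : ℝ → ℝ} {α β m M l : ℝ} (hα : -1 < α) (hβ : -1 < β)
    (hm : 0 < m) (hgl : ∀ y ∈ Ioo (-1 : ℝ) 1, m ≤ g y) (hgu : ∀ y ∈ Ioo (-1 : ℝ) 1, g y ≤ M)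
    (hgm : AEStronglyMeasurable g (volume.restrict (Ioo (-1) 1)))
    (hlim : Tendsto g (nhdsWithin 0 (Ioi 0)) (nhds l))
    (hv : ∀ x, v x = g x * (1 - x) ^ α * (1 + x) ^ β) :
    ∃ k B, IsRegularRight v k B l := by
  have hM : m ≤ M := (hgl 0 (by norm_num)).trans (hgu 0 (by norm_num))
  have hM0 : 0 < M := hm.trans_le hM
  obtain ⟨k, hk⟩ := exists_nat_ge (|α| + |β| + 1)
  have hkα : |α| ≤ k := by linarith [abs_nonneg β]
  have hkβ : |β| ≤ k := by linarith [abs_nonneg α]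
  have hk1 : 1 ≤ k := by
    have : (1 : ℝ) ≤ k := by linarith [abs_nonneg α, abs_nonneg β]
    exact_mod_cast this
  have hsq : ∀ y : ℝ, 1 - y ^ 2 = (1 - y) * (1 + y) := fun y => by ring
  refine ⟨k, 16 ^ k * (M + 1 / m), ?_, by positivity, ?_, ?_, ?_, ?_⟩
  · have h1 := intervalIntegrable_jacobi hα hβ
    rw [intervalIntegrable_iff_integrableOn_Ioo_of_le (by norm_num)] at h1 ⊢
    have h2 := h1.bdd_mul hgm (c := M) (by
      filter_upwards [ae_restrict_mem measurableSet_Ioo] with y hy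
      rw [Real.norm_eq_abs, abs_of_pos (hm.trans_le (hgl y hy))]
      exact hgu y hy)
    refine h2.congr (ae_of_all _ fun y => ?_)
    simp only [hv]; ring
  · refine hm.trans_le (ge_of_tendsto hlim ?_)
    filter_upwards [Ioo_mem_nhdsGT (show (0 : ℝ) < 1 by norm_num)] with y hy
    exact hgl y ⟨by linarith [hy.1], hy.2⟩
  · intro y hy
    have hu : 0 < 1 - y := by linarith [hy.2]
    have hw : 0 < 1 + y := by linarith [hy.1]
    have h1 := pow_mul_rpow_le hu (by linarith [hy.1]) hkα
    have h2 := pow_mul_rpow_le hw (by linarith [hy.2]) hkβ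
    have hg0 := hm.trans_le (hgl y hy)
    have hle : (1 - y ^ 2) ^ k ≤ 1 :=
      pow_le_one₀ (by rw [hsq]; positivity) (by nlinarith)
    calc ((1 - y ^ 2) ^ k) ^ 2 * v y = (1 - y ^ 2) ^ k *
          (((1 - y) ^ k * (1 - y) ^ α) * ((1 + y) ^ k * (1 + y) ^ β)) * g y := by
          rw [hv, hsq, mul_pow]; ring
      _ ≤ 1 * (4 ^ k * 4 ^ k) * M := by
          gcongr
          exact hgu y hy
      _ = 16 ^ k * M := by rw [one_mul, ← mul_pow]; norm_num
      _ ≤ _ := by gcongr; linarith [(by positivity : 0 < 1 / m)]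
  · intro y hy
    have hu : 0 < 1 - y := by linarith [hy.2]
    have hw : 0 < 1 + y := by linarith [hy.1]
    have h1 := pow_le_mul_rpow hu (by linarith [hy.1]) hkα
    have h2 := pow_le_mul_rpow hw (by linarith [hy.2]) hkβ
    have hg0 := hgl y hy
    have hpos : 0 < 1 - y ^ 2 := by rw [hsq]; positivity
    have hle : (1 - y ^ 2) ^ (k - 1) ≤ 1 := pow_le_one₀ hpos.le (by nlinarith)
    have hch := one_sub_sq_mul_chebyshevWeight_le hy
    have hch0 := chebyshevWeight_pos hy
    calc ((1 - y ^ 2) ^ k) ^ 2 * chebyshevWeight y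
        = (1 - y ^ 2) ^ k * ((1 - y ^ 2) ^ (k - 1) * ((1 - y ^ 2) * chebyshevWeight y)) := by
          obtain ⟨i, rfl⟩ : ∃ i, k = i + 1 := ⟨k - 1, by omega⟩
          simp only [Nat.add_sub_cancel]; ring
      _ ≤ (1 - y ^ 2) ^ k * (1 * 1) := by gcongr
      _ = (1 - y) ^ k * (1 + y) ^ k := by rw [hsq, mul_pow]; ring
      _ ≤ (4 ^ k * (1 - y) ^ α) * (4 ^ k * (1 + y) ^ β) := by gcongr
      _ = 16 ^ k * (1 / m) * m * ((1 - y) ^ α * (1 + y) ^ β) := by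
          rw [(by norm_num : (16 : ℝ) = 4 * 4), mul_pow]; field_simp
      _ ≤ 16 ^ k * (M + 1 / m) * g y * ((1 - y) ^ α * (1 + y) ^ β) := by
          gcongr
          linarith
      _ = _ := by rw [hv]; ring
  · have h1 : Tendsto (fun x : ℝ => (1 - x) ^ α * (1 + x) ^ β) (nhdsWithin 0 (Ioi 0)) (nhds 1) := by
      have : ContinuousAt (fun x : ℝ => (1 - x) ^ α * (1 + x) ^ β) 0 := by
        refine ContinuousAt.mul ?_ ?_ <;>
          exact ContinuousAt.rpow_const (by fun_prop) (Or.inl (by norm_num))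
      have h2 := this.tendsto
      simp only [sub_zero, add_zero, Real.one_rpow, mul_one] at h2
      exact h2.mono_left nhdsWithin_le_nhds
    have h3 := hlim.mul h1
    rw [mul_one] at h3
    refine h3.congr fun x => ?_
    rw [hv]; ring

end Jacobi

section Reflection

lemma weightIntegral_comp_neg (v : ℝ → ℝ) (p : ℝ[X]) :
    weightIntegral (fun y => v (-y)) (p.comp (-X)) = weightIntegral v p := by
  have := intervalIntegral.integral_comp_neg (a := (-1 : ℝ)) (b := 1)
    (fun y => p.eval y * v y)
  simp only [neg_neg] at this
  unfold weightIntegral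
  simpa [eval_comp] using this

lemma weightIntegral_comp_neg_mul_X_pow {v : ℝ → ℝ} {p : ℝ[X]} {k : ℕ}
    (h : weightIntegral v (p * X ^ k) = 0) :
    weightIntegral (fun y => v (-y)) (p.comp (-X) * X ^ k) = 0 := by
  have h1 : p.comp (-X) * X ^ k = C ((-1) ^ k) * (p * X ^ k).comp (-X) := by
    rw [mul_comp, pow_comp, X_comp, neg_pow (X : ℝ[X]) k, C_pow, C_neg, C_1]
    have h2 : ((-1 : ℝ[X]) ^ k) * (-1) ^ k = 1 := by rw [← mul_pow]; simp
    linear_combination (-(p.comp (-X) * X ^ k)) * h2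
  rw [h1, weightIntegral_C_mul, weightIntegral_comp_neg, h, mul_zero]

end Reflection

theorem stmt7
    (α β c : ℝ) (hα : -1 < α) (hβ : -1 < β) (hc : 0 < c)
    (h : ℝ → ℝ)
    (h_an : AnalyticOnNhd ℝ h (Icc (-1) 1))
    (h_pos : ∀ x ∈ Icc (-1 : ℝ) 1, 0 < h x)
    -- the weight w_c(x) = h(x)(1-x)^α(1+x)^β Ξ_c(x)
    (w : ℝ → ℝ)
    (hw : ∀ x : ℝ, w x = h x * (1 - x) ^ α * (1 + x) ^ β * (if x < 0 then 1 else c ^ 2))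
    -- the monic orthogonal polynomials with respect to w_c
    (P : ℕ → Polynomial ℝ)
    (hP_monic : ∀ n, (P n).Monic)
    (hP_deg : ∀ n, (P n).natDegree = n)
    (hP_orth : ∀ n, ∀ k < n, ∫ x in (-1 : ℝ)..1, (P n).eval x * x ^ k * w x = 0)
    -- the zeros x_j^{(n)} of Pₙ, enumerated by j ∈ ℤ so that
    -- ⋯ < x_{-1}^{(n)} < 0 ≤ x_0^{(n)} < x_1^{(n)} < ⋯ ; the zero of index j is
    -- defined for n ≥ N0 j
    (N0 : ℤ → ℕ) (xz : ℕ → ℤ → ℝ)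
    (hx_zero : ∀ (j : ℤ) (n : ℕ), N0 j ≤ n → (P n).eval (xz n j) = 0)
    (hx_mono : ∀ (j : ℤ) (n : ℕ), N0 j ≤ n → N0 (j + 1) ≤ n → xz n j < xz n (j + 1))
    (hx_sign0 : ∀ n : ℕ, N0 0 ≤ n → 0 ≤ xz n 0)
    (hx_signm : ∀ n : ℕ, N0 (-1) ≤ n → xz n (-1) < 0)
    (hx_min : ∀ n : ℕ, N0 0 ≤ n → ∀ t : ℝ, (P n).eval t = 0 → 0 ≤ t → xz n 0 ≤ t)
    (hx_consec : ∀ (j : ℤ) (n : ℕ), N0 j ≤ n → N0 (j + 1) ≤ n →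
      ∀ t : ℝ, (P n).eval t = 0 → ¬(xz n j < t ∧ t < xz n (j + 1))) :
    -- clock behavior is recovered in the limit j → ±∞:
    -- lim_{j→±∞} liminf_n (n/π)(x_{j+1} − x_j) = lim_{j→±∞} limsup_n (n/π)(x_{j+1} − x_j) = 1
    Tendsto (fun j : ℕ =>
        Filter.liminf (fun n : ℕ =>
          (n : ℝ) / Real.pi * (xz n ((j : ℤ) + 1) - xz n (j : ℤ))) atTop)
      atTop (nhds 1) ∧
    Tendsto (fun j : ℕ =>
        Filter.limsup (fun n : ℕ =>
          (n : ℝ) / Real.pi * (xz n ((j : ℤ) + 1) - xz n (j : ℤ))) atTop)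
      atTop (nhds 1) ∧
    Tendsto (fun j : ℕ =>
        Filter.liminf (fun n : ℕ =>
          (n : ℝ) / Real.pi * (xz n (-(j : ℤ) + 1) - xz n (-(j : ℤ)))) atTop)
      atTop (nhds 1) ∧
    Tendsto (fun j : ℕ =>
        Filter.limsup (fun n : ℕ =>
          (n : ℝ) / Real.pi * (xz n (-(j : ℤ) + 1) - xz n (-(j : ℤ)))) atTop)
      atTop (nhds 1) := by
  have hcont : ContinuousOn h (Icc (-1) 1) := h_an.continuousOn
  obtain ⟨a, ha, hamin⟩ := isCompact_Icc.exists_isMinOn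
    (nonempty_Icc.2 (by norm_num : (-1 : ℝ) ≤ 1)) hcont
  obtain ⟨b, hb, hbmax⟩ := isCompact_Icc.exists_isMaxOn
    (nonempty_Icc.2 (by norm_num : (-1 : ℝ) ≤ 1)) hcont
  have hm0 := h_pos a ha
  have hM0 := h_pos b hb
  have hc2 : 0 < c ^ 2 := by positivity
  set g : ℝ → ℝ := fun x => h x * (if x < 0 then 1 else c ^ 2) with hg
  set m := h a * min 1 (c ^ 2) with hm
  set M := h b * max 1 (c ^ 2) with hM
  have hmpos : 0 < m := by positivity
  have hgl : ∀ y ∈ Ioo (-1 : ℝ) 1, m ≤ g y := fun y hy => by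
    have h1 : h a ≤ h y := hamin (Ioo_subset_Icc_self hy)
    refine mul_le_mul h1 ?_ (by positivity) (hm0.le.trans h1)
    split_ifs
    exacts [min_le_left _ _, min_le_right _ _]
  have hgu : ∀ y ∈ Ioo (-1 : ℝ) 1, g y ≤ M := fun y hy => by
    have h1 : h y ≤ h b := hbmax (Ioo_subset_Icc_self hy)
    refine mul_le_mul h1 ?_ (by split_ifs <;> positivity) hM0.le
    split_ifs
    exacts [le_max_left _ _, le_max_right _ _]
  have hneg : ∀ y ∈ Ioo (-1 : ℝ) 1, -y ∈ Ioo (-1 : ℝ) 1 := fun y hy =>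
    ⟨by linarith [hy.2], by linarith [hy.1]⟩
  have hcont' : ContinuousOn h (Ioo (-1) 1) := hcont.mono Ioo_subset_Icc_self
  have hgm : AEStronglyMeasurable g (volume.restrict (Ioo (-1) 1)) :=
    (hcont'.aestronglyMeasurable measurableSet_Ioo).mul
      (Measurable.ite measurableSet_Iio measurable_const measurable_const).aestronglyMeasurable
  have hgm' : AEStronglyMeasurable (fun y => g (-y)) (volume.restrict (Ioo (-1) 1)) :=
    ((hcont'.comp continuousOn_neg hneg).aestronglyMeasurable measurableSet_Ioo).mul
      (Measurable.ite (measurableSet_Iio.preimage measurable_neg) measurable_const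
        measurable_const).aestronglyMeasurable
  have hcont0 : ContinuousAt h 0 := (h_an 0 (by norm_num)).continuousAt
  have hlim : Tendsto g (nhdsWithin 0 (Ioi 0)) (nhds (h 0 * c ^ 2)) := by
    refine ((hcont0.tendsto.mono_left nhdsWithin_le_nhds).mul_const (c ^ 2)).congr' ?_
    filter_upwards [self_mem_nhdsWithin] with x hx
    simp only [hg, if_neg (not_lt.2 (le_of_lt (mem_Ioi.1 hx)))]
  have hlim' : Tendsto (fun y => g (-y)) (nhdsWithin 0 (Ioi 0)) (nhds (h 0)) := by
    have h1 : Tendsto (fun y : ℝ => h (-y)) (nhds 0) (nhds (h 0)) := by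
      have := hcont0.tendsto.comp (continuous_neg.tendsto' (0 : ℝ) 0 neg_zero)
      exact this
    refine (h1.mono_left nhdsWithin_le_nhds).congr' ?_
    filter_upwards [self_mem_nhdsWithin] with x hx
    have : -x < 0 := neg_lt_zero.2 hx
    simp only [hg, if_pos this, mul_one]
  obtain ⟨k, B, hreg⟩ := exists_isRegularRight hα hβ hmpos hgl hgu hgm hlim (v := w)
    (fun x => by rw [hw]; ring)
  obtain ⟨k', B', hreg'⟩ := exists_isRegularRight hβ hα hmpos
    (fun y hy => hgl _ (hneg y hy)) (fun y hy => hgu _ (hneg y hy)) hgm' hlim'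
    (v := fun y => w (-y)) (fun x => by rw [hw]; simp only [hg, sub_neg_eq_add]; ring_nf)
  have horth : ∀ n, ∀ i < n, weightIntegral w (P n * X ^ i) = 0 := fun n i hi => by
    unfold weightIntegral
    simpa using hP_orth n i hi
  have hPne : ∀ n, P n ≠ 0 := fun n => (hP_monic n).ne_zero
  have hsucc : ∀ j : ℕ, -1 - ((j : ℕ) : ℤ) = -1 - ((j + 1 : ℕ) : ℤ) + 1 := fun j => by
    push_cast; ring
  have hR := fun (e : ℝ) (he : 0 < e) (he1 : e < 1) =>
    hreg.clock (e := e) hPne hP_deg horth (N := fun j => N0 j) (y := fun n j => xz n j)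
      (fun j n hn => hx_zero j n hn)
      (fun j n hn hn' => by
        push_cast at hn' ⊢
        exact hx_mono j n hn hn')
      hx_sign0
      ((eventually_ge_atTop (N0 0)).mono fun n hn t ht ht0 => hx_min n hn t ht ht0.le)
      (fun j n hn hn' t ht => by
        push_cast at hn' ⊢
        exact hx_consec j n hn hn' t ht) he he1
  have hzero' : ∀ n t, ((P n).comp (-X)).eval t = 0 → (P n).eval (-t) = 0 := fun n t ht => by
    simpa [eval_comp] using ht
  have hdeg' : ∀ n, ((P n).comp (-X)).natDegree = n := fun n => by
    rw [natDegree_comp, natDegree_neg, natDegree_X, mul_one, hP_deg]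
  have hL := fun (e : ℝ) (he : 0 < e) (he1 : e < 1) =>
    hreg'.clock (e := e) (P := fun n => (P n).comp (-X))
      (fun n h0 => by
        rcases comp_eq_zero_iff.1 h0 with h1 | ⟨-, h1⟩
        · exact hPne n h1
        · simpa using congrArg natDegree h1)
      hdeg' (fun n i hi => weightIntegral_comp_neg_mul_X_pow (horth n i hi))
      (N := fun j => N0 (-1 - j)) (y := fun n j => -xz n (-1 - j))
      (fun j n hn => by simpa [eval_comp] using hx_zero _ n hn)
      (fun j n hn hn' => by
        rw [hsucc] at hn
        have := hx_mono _ n hn' hn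
        rw [← hsucc] at this
        exact neg_lt_neg this)
      (fun n hn => by
        have := hx_signm n (by simpa using hn)
        simpa using this.le)
      (by
        filter_upwards [eventually_ge_atTop (N0 (-1)), eventually_ge_atTop (N0 0)]
          with n hn hn' t ht ht0
        have h1 := hx_consec (-1) n hn (by simpa using hn') _ (hzero' n t ht)
        have h2 := hx_sign0 n hn'
        simp only [Nat.cast_zero, sub_zero]
        by_contra! h3
        exact h1 ⟨by linarith, by simp only [neg_add_cancel]; linarith⟩)
      (fun j n hn hn' t ht ⟨h1, h2⟩ => by
        rw [hsucc] at hn h1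
        exact hx_consec _ n hn' hn _ (hzero' n t ht) ⟨by linarith, by linarith⟩) he he1
  have h1 := tendsto_liminf_limsup_of_eventually_abs_sub_le (l := 1)
    (f := fun j n => (n : ℝ) / Real.pi * (xz n ((j : ℤ) + 1) - xz n (j : ℤ)))
    (fun e he he1 => by simpa using hR e he he1)
  have h2 := tendsto_liminf_limsup_of_eventually_abs_sub_le (l := 1)
    (f := fun j n => (n : ℝ) / Real.pi * (xz n (-(j : ℤ) + 1) - xz n (-(j : ℤ))))
    (fun e he he1 => by
      obtain ⟨J, hJ⟩ := hL e he he1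
      refine ⟨J + 2, fun j hj => ?_⟩
      obtain ⟨i, rfl⟩ : ∃ i, j = i + 2 := ⟨j - 2, by omega⟩
      filter_upwards [hJ i (by omega)] with n hn
      have e1 : -((i + 2 : ℕ) : ℤ) + 1 = -1 - (i : ℤ) := by push_cast; ring
      have e2 : -((i + 2 : ℕ) : ℤ) = -1 - ((i + 1 : ℕ) : ℤ) := by push_cast; ring
      rw [e1, e2]
      rwa [sub_neg_eq_add, neg_add_eq_sub] at hn)
  exact ⟨h1.1, h1.2, h2.1, h2.2⟩
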